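/- Suppose V is a cofree G-module and Y ⊆ V is a G-stable algebraic subset such that Y_pr is Zariski dense in Y. Then Y is G-reduced. -/

import Mathlib

/-!
Common framework: a "compact Lie group / complex reductive group acting on a
finite-dimensional module" is modelled as a subgroup of invertible `n × n`
matrices over `𝕜 = ℝ` or `ℂ` acting on `Fin n → 𝕜` by `Matrix.mulVec`.
Polynomial functions on the module are `MvPolynomial (Fin n) 𝕜`.
-/

set_option synthInstance.maxHeartbeats 1000000
set_option maxHeartbeats 1000000

noncomputable section

open MvPolynomial

namespace ZPaper

variable (𝕜 : Type) [RCLike 𝕜] (n : ℕ)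

/-- The zero set of a family of polynomials. -/
def zeroSet (S : Set (MvPolynomial (Fin n) 𝕜)) : Set (Fin n → 𝕜) :=
  {v | ∀ p ∈ S, eval v p = 0}

/-- A subset of `𝕜ⁿ` is algebraic if it is the zero set of a family of polynomials. -/
def IsAlgebraicSet (X : Set (Fin n → 𝕜)) : Prop :=
  ∃ S : Set (MvPolynomial (Fin n) 𝕜), X = zeroSet 𝕜 n S

/-- The vanishing ideal `I(X)` of a subset `X ⊆ 𝕜ⁿ`. -/
def vanishingIdeal (X : Set (Fin n → 𝕜)) : Ideal (MvPolynomial (Fin n) 𝕜) where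
  carrier := {p | ∀ x ∈ X, eval x p = 0}
  zero_mem' := by intro x _; simp
  add_mem' := by intro a b ha hb x hx; simp [ha x hx, hb x hx]
  smul_mem' := by intro c p hp x hx; simp [smul_eq_mul, hp x hx]

/-- The Zariski closure of a subset of `𝕜ⁿ`. -/
def zclosure (A : Set (Fin n → 𝕜)) : Set (Fin n → 𝕜) :=
  zeroSet 𝕜 n (vanishingIdeal 𝕜 n A : Set (MvPolynomial (Fin n) 𝕜))

/-- `A` is Zariski dense in `X`: every polynomial vanishing on `A` vanishes on `X`. -/
def ZDenseIn (A X : Set (Fin n → 𝕜)) : Prop :=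
  ∀ p : MvPolynomial (Fin n) 𝕜, (∀ a ∈ A, eval a p = 0) → ∀ x ∈ X, eval x p = 0

/-- A set of matrices is a subgroup of `GL_n(𝕜)`. -/
def IsMatSubgroup (G : Set (Matrix (Fin n) (Fin n) 𝕜)) : Prop :=
  (1 : Matrix (Fin n) (Fin n) 𝕜) ∈ G ∧ (∀ a ∈ G, ∀ b ∈ G, a * b ∈ G) ∧
    ∀ a ∈ G, IsUnit a ∧ a⁻¹ ∈ G

/-- `X` is a `G`-stable subset of `𝕜ⁿ`. -/
def Stabilizes (G : Set (Matrix (Fin n) (Fin n) 𝕜)) (X : Set (Fin n → 𝕜)) : Prop :=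
  ∀ g ∈ G, ∀ x ∈ X, Matrix.mulVec g x ∈ X

/-- A polynomial is `G`-invariant. -/
def Invariant (G : Set (Matrix (Fin n) (Fin n) 𝕜)) (p : MvPolynomial (Fin n) 𝕜) : Prop :=
  ∀ g ∈ G, ∀ v : Fin n → 𝕜, eval (Matrix.mulVec g v) p = eval v p

/-- `I_G(X)`: the ideal generated by the `G`-invariant polynomials vanishing on `X`,
i.e. by `I(X)^G = I(X) ∩ 𝕜[V]^G`. -/
def invariantIdeal (G : Set (Matrix (Fin n) (Fin n) 𝕜)) (X : Set (Fin n → 𝕜)) :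
    Ideal (MvPolynomial (Fin n) 𝕜) :=
  Ideal.span {p | Invariant 𝕜 n G p ∧ ∀ x ∈ X, eval x p = 0}

/-- `X` is `G`-reduced: `I_G(X) = I(X)`. -/
def IsGReduced (G : Set (Matrix (Fin n) (Fin n) 𝕜)) (X : Set (Fin n → 𝕜)) : Prop :=
  invariantIdeal 𝕜 n G X = vanishingIdeal 𝕜 n X

/-- `X` is almost `G`-reduced: `√I_G(X) = I(X)`. -/
def IsAlmostGReduced (G : Set (Matrix (Fin n) (Fin n) 𝕜)) (X : Set (Fin n → 𝕜)) : Prop :=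
  (invariantIdeal 𝕜 n G X).radical = vanishingIdeal 𝕜 n X

/-- The orbit `G·v`. -/
def orbit (G : Set (Matrix (Fin n) (Fin n) 𝕜)) (v : Fin n → 𝕜) : Set (Fin n → 𝕜) :=
  (fun g => Matrix.mulVec g v) '' G

/-- The isotropy group `G_v`. -/
def isotropy (G : Set (Matrix (Fin n) (Fin n) 𝕜)) (v : Fin n → 𝕜) :
    Set (Matrix (Fin n) (Fin n) 𝕜) :=
  {g ∈ G | Matrix.mulVec g v = v}

/-- Matrix exponential. -/
def mexp (A : Matrix (Fin n) (Fin n) 𝕜) : Matrix (Fin n) (Fin n) 𝕜 :=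
  ∑' k : ℕ, ((k.factorial : 𝕜)⁻¹) • A ^ k

/-- The Lie algebra of a matrix group: matrices whose one-parameter subgroup lies in `G`. -/
def lieAlgebra (G : Set (Matrix (Fin n) (Fin n) 𝕜)) : Set (Matrix (Fin n) (Fin n) 𝕜) :=
  {A | ∀ t : 𝕜, mexp 𝕜 n (t • A) ∈ G}

/-- The tangent space `T_v(G·v)` to the orbit, i.e. `𝔤·v`. -/
def orbitTangent (G : Set (Matrix (Fin n) (Fin n) 𝕜)) (v : Fin n → 𝕜) :
    Submodule 𝕜 (Fin n → 𝕜) :=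
  Submodule.span 𝕜 ((fun A => Matrix.mulVec A v) '' lieAlgebra 𝕜 n G)

/-- `N` is a `G_v`-stable complement to `T_v(G·v)` in `𝕜ⁿ` (a slice at `v`). -/
def IsSliceComplement (G : Set (Matrix (Fin n) (Fin n) 𝕜)) (v : Fin n → 𝕜)
    (N : Submodule 𝕜 (Fin n → 𝕜)) : Prop :=
  IsCompl (orbitTangent 𝕜 n G v) N ∧
    ∀ g ∈ isotropy 𝕜 n G v, ∀ x ∈ N, Matrix.mulVec g x ∈ N

/-- The image of `H` in `GL(N)` is trivial. -/
def ActsTriviallyOn (H : Set (Matrix (Fin n) (Fin n) 𝕜))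
    (N : Submodule 𝕜 (Fin n → 𝕜)) : Prop :=
  ∀ g ∈ H, ∀ x ∈ N, Matrix.mulVec g x = x

/-- The image of `H` in `GL(N)` is finite. -/
def HasFiniteImageOn (H : Set (Matrix (Fin n) (Fin n) 𝕜))
    (N : Submodule 𝕜 (Fin n → 𝕜)) : Prop :=
  Set.Finite ((fun g => fun x : N => Matrix.mulVec g (x : Fin n → 𝕜)) '' H)

/-- The orbit `G·v` is (Zariski) closed. -/
def HasClosedOrbit (G : Set (Matrix (Fin n) (Fin n) 𝕜)) (v : Fin n → 𝕜) : Prop :=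
  zclosure 𝕜 n (orbit 𝕜 n G v) ⊆ orbit 𝕜 n G v

/-- `v` lies on a principal orbit: `G·v` is closed and the isotropy group acts trivially on
some (hence any) slice at `v`. -/
def IsPrincipalPt (G : Set (Matrix (Fin n) (Fin n) 𝕜)) (v : Fin n → 𝕜) : Prop :=
  HasClosedOrbit 𝕜 n G v ∧
    ∃ N, IsSliceComplement 𝕜 n G v N ∧ ActsTriviallyOn 𝕜 n (isotropy 𝕜 n G v) N

/-- `v` lies on an almost principal orbit. -/
def IsAlmostPrincipalPt (G : Set (Matrix (Fin n) (Fin n) 𝕜)) (v : Fin n → 𝕜) : Prop :=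
  HasClosedOrbit 𝕜 n G v ∧
    ∃ N, IsSliceComplement 𝕜 n G v N ∧ HasFiniteImageOn 𝕜 n (isotropy 𝕜 n G v) N

/-- The set of principal points `V_pr`. -/
def prPoints (G : Set (Matrix (Fin n) (Fin n) 𝕜)) : Set (Fin n → 𝕜) :=
  {v | IsPrincipalPt 𝕜 n G v}

/-- The set of almost principal points `V_apr`. -/
def aprPoints (G : Set (Matrix (Fin n) (Fin n) 𝕜)) : Set (Fin n → 𝕜) :=
  {v | IsAlmostPrincipalPt 𝕜 n G v}

/-- `π⁻¹(π(Y))`: all points that the invariants cannot separate from `Y`. -/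
def saturation (G : Set (Matrix (Fin n) (Fin n) 𝕜)) (Y : Set (Fin n → 𝕜)) :
    Set (Fin n → 𝕜) :=
  {v | ∃ y ∈ Y, ∀ p, Invariant 𝕜 n G p → eval v p = eval y p}

/-- `Y` is `G`-saturated: `Y = π⁻¹(π(Y))`. -/
def IsSaturated (G : Set (Matrix (Fin n) (Fin n) 𝕜)) (Y : Set (Fin n → 𝕜)) : Prop :=
  Y = saturation 𝕜 n G Y

/-- The fiber `π⁻¹(π(v))` of the quotient morphism. -/
def piFiber (G : Set (Matrix (Fin n) (Fin n) 𝕜)) (v : Fin n → 𝕜) : Set (Fin n → 𝕜) :=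
  {u | ∀ p, Invariant 𝕜 n G p → eval u p = eval v p}

/-- The invariant ring `𝕜[V]^G` as a subalgebra of `𝕜[V]`. -/
def invariantSubalgebra (G : Set (Matrix (Fin n) (Fin n) 𝕜)) :
    Subalgebra 𝕜 (MvPolynomial (Fin n) 𝕜) where
  carrier := {p | Invariant 𝕜 n G p}
  mul_mem' := by intro a b ha hb g hg v; simp [ha g hg v, hb g hg v]
  one_mem' := by intro g hg v; simp
  add_mem' := by intro a b ha hb g hg v; simp [ha g hg v, hb g hg v]
  zero_mem' := by intro g hg v; simp
  algebraMap_mem' := by intro r g hg v; simp [MvPolynomial.algebraMap_eq]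

/-- The representation is cofree: `𝕜[V]` is a free module over `𝕜[V]^G`. -/
def IsCofree (G : Set (Matrix (Fin n) (Fin n) 𝕜)) : Prop :=
  Module.Free ↥(invariantSubalgebra 𝕜 n G) (MvPolynomial (Fin n) 𝕜)

/-- The vanishing ideal of `π(Y)` in `𝕜[V//G] = 𝕜[V]^G`. -/
def quotVanishingIdeal (G : Set (Matrix (Fin n) (Fin n) 𝕜)) (Y : Set (Fin n → 𝕜)) :
    Ideal ↥(invariantSubalgebra 𝕜 n G) where
  carrier := {p | ∀ y ∈ Y, eval y (p : MvPolynomial (Fin n) 𝕜) = 0}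
  zero_mem' := by intro y hy; simp
  add_mem' := by intro a b ha hb y hy; simp [ha y hy, hb y hy]
  smul_mem' := by intro c p hp y hy; simp [smul_eq_mul, hp y hy]

/-- The module is stable: there is a nonempty Zariski-open set of points with closed orbit. -/
def IsStableModule (G : Set (Matrix (Fin n) (Fin n) 𝕜)) : Prop :=
  ∃ U : Set (Fin n → 𝕜), U.Nonempty ∧ IsAlgebraicSet 𝕜 n Uᶜ ∧
    ∀ v ∈ U, HasClosedOrbit 𝕜 n G v

/-- `G` is Zariski closed in `GL_n(𝕜)`. -/
def IsZClosedInGL (G : Set (Matrix (Fin n) (Fin n) 𝕜)) : Prop :=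
  ∃ P : Set (MvPolynomial (Fin n × Fin n) 𝕜),
    G = {g | IsUnit g ∧ ∀ p ∈ P, eval (fun ij => g ij.1 ij.2) p = 0}

/-- `G` is a (linearly) reductive algebraic group: a Zariski closed subgroup of `GL_n`
containing a Zariski-dense compact subgroup (the unitarian trick characterization). -/
def IsReductiveGroup (G : Set (Matrix (Fin n) (Fin n) 𝕜)) : Prop :=
  IsMatSubgroup 𝕜 n G ∧ IsZClosedInGL 𝕜 n G ∧
    ∃ K : Set (Matrix (Fin n) (Fin n) 𝕜), K ⊆ G ∧ IsCompact K ∧ IsMatSubgroup 𝕜 n K ∧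
      ∀ p : MvPolynomial (Fin n × Fin n) 𝕜,
        (∀ k ∈ K, eval (fun ij => k ij.1 ij.2) p = 0) →
          ∀ g ∈ G, eval (fun ij => g ij.1 ij.2) p = 0

/-- The isotropy groups of `v` and `w` are conjugate in `G`. -/
def ConjIsotropy (G : Set (Matrix (Fin n) (Fin n) 𝕜)) (v w : Fin n → 𝕜) : Prop :=
  ∃ g ∈ G, isotropy 𝕜 n G w = (fun h => g * h * g⁻¹) '' isotropy 𝕜 n G v

/-- The (Luna) stratum of `V` determined by a point `v` with closed orbit: the inverse image
under `π` of the set of closed orbits with isotropy group conjugate to `G_v`. -/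
def stratumOf (G : Set (Matrix (Fin n) (Fin n) 𝕜)) (v : Fin n → 𝕜) : Set (Fin n → 𝕜) :=
  {u | ∃ w, HasClosedOrbit 𝕜 n G w ∧ w ∈ zclosure 𝕜 n (orbit 𝕜 n G u) ∧
    ConjIsotropy 𝕜 n G v w}

/-- Dimension of (the Zariski closure of) a subset of `𝕜ⁿ`, as the Krull dimension of its
coordinate ring. -/
def adim (X : Set (Fin n → 𝕜)) : WithBot ℕ∞ :=
  ringKrullDim (MvPolynomial (Fin n) 𝕜 ⧸ vanishingIdeal 𝕜 n X)

/-- A nonempty algebraic set with prime vanishing ideal, i.e. an irreducible algebraic set. -/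
def IsIrredAlg (Z : Set (Fin n → 𝕜)) : Prop :=
  IsAlgebraicSet 𝕜 n Z ∧ Z.Nonempty ∧ (vanishingIdeal 𝕜 n Z).IsPrime

/-- `Z` is an irreducible component of `Y`. -/
def IsIrredComponentOf (Y Z : Set (Fin n → 𝕜)) : Prop :=
  IsIrredAlg 𝕜 n Z ∧ Z ⊆ Y ∧
    ∀ Z', IsIrredAlg 𝕜 n Z' → Z ⊆ Z' → Z' ⊆ Y → Z' = Z

/-- The rank at `v` of the differential of `f = (f_1, …, f_d) : V → 𝕜^d`. -/
def jacRank {d : ℕ} (f : Fin d → MvPolynomial (Fin n) 𝕜) (v : Fin n → 𝕜) : ℕ :=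
  (Matrix.of fun (i : Fin d) (j : Fin n) => eval v (pderiv j (f i))).rank

/-- A polynomial is `H`-invariant as a function on the submodule `N`. -/
def InvariantOn (H : Set (Matrix (Fin n) (Fin n) 𝕜)) (N : Submodule 𝕜 (Fin n → 𝕜))
    (p : MvPolynomial (Fin n) 𝕜) : Prop :=
  ∀ g ∈ H, ∀ x ∈ N, eval (Matrix.mulVec g x) p = eval x p

/-- The null cone of the `H`-module `N`: points of `N` which the `H`-invariant functions on `N`
cannot separate from `0`. -/
def sliceNullCone (H : Set (Matrix (Fin n) (Fin n) 𝕜)) (N : Submodule 𝕜 (Fin n → 𝕜)) :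
    Set (Fin n → 𝕜) :=
  {x | x ∈ N ∧ ∀ p, InvariantOn 𝕜 n H N p → eval x p = eval (0 : Fin n → 𝕜) p}

/-- The `H`-module `N` is coreduced: the vanishing ideal of its null cone in `𝕜[N]` is
generated by `H`-invariant functions.  (Stated in `𝕜[V]`: the vanishing ideal of the null
cone equals the ideal generated by the invariant functions vanishing on it together with the
vanishing ideal of `N`.) -/
def CoreducedOn (H : Set (Matrix (Fin n) (Fin n) 𝕜)) (N : Submodule 𝕜 (Fin n → 𝕜)) : Prop :=
  vanishingIdeal 𝕜 n (sliceNullCone 𝕜 n H N) =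
    Ideal.span ({p | InvariantOn 𝕜 n H N p ∧ ∀ x ∈ sliceNullCone 𝕜 n H N, eval x p = 0} ∪
      {p | ∀ x ∈ (N : Set (Fin n → 𝕜)), eval x p = 0})

/-- Complexification of a real vector. -/
def cVec (w : Fin n → ℝ) : Fin n → ℂ := fun i => (w i : ℂ)

/-- The complexification `G = K_ℂ` of a compact matrix group `K ⊆ GL_n(ℝ)`: the Zariski
closure of `K` in the complex matrices. -/
def complexifiedGroup (K : Set (Matrix (Fin n) (Fin n) ℝ)) :
    Set (Matrix (Fin n) (Fin n) ℂ) :=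
  {g | ∀ p : MvPolynomial (Fin n × Fin n) ℂ,
    (∀ k ∈ K, eval (fun ij => (k ij.1 ij.2 : ℂ)) p = 0) →
      eval (fun ij => g ij.1 ij.2) p = 0}

/-- The complexification `Y = X_ℂ ⊆ ℂⁿ` of `X ⊆ ℝⁿ`: the Zariski closure of `X` in `ℂⁿ`. -/
def complexification (X : Set (Fin n → ℝ)) : Set (Fin n → ℂ) :=
  zclosure ℂ n (cVec n '' X)

open TensorProduct in
/-- In a reduced algebra over a field of characteristic zero, the two coprojections to the tensor
square agree up to nilpotents only on scalars. -/
lemma mem_range_of_isNilpotent_sub {F R : Type*} [Field F] [CharZero F] [CommRing R] [Algebra F R]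
    [IsReduced R] [Nontrivial R] (e : R)
    (h : IsNilpotent ((e ⊗ₜ[F] (1 : R)) - (1 : R) ⊗ₜ[F] e)) :
    ∃ c : F, algebraMap F R c = e := by
  classical
  let φ : Polynomial F →ₐ[F] R := Polynomial.aeval e
  let Q := Polynomial F ⧸ RingHom.ker φ
  let ψ : Q →ₐ[F] R := Ideal.kerLiftAlg φ
  have hψ : Function.Injective ψ := Ideal.kerLiftAlg_injective φ
  let x : Q := Ideal.Quotient.mk _ Polynomial.X
  have hx : ψ x = e := (Ideal.kerLiftAlg_mk φ Polynomial.X).trans (Polynomial.aeval_X e)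
  have hinj : Function.Injective (Algebra.TensorProduct.map ψ ψ) :=
    TensorProduct.map_injective_of_flat_flat ψ.toLinearMap ψ.toLinearMap hψ hψ
  have hQ : IsNilpotent ((x ⊗ₜ[F] (1 : Q)) - (1 : Q) ⊗ₜ[F] x) := by
    rw [← IsNilpotent.map_iff hinj]
    simpa [hx] using h
  have key : ∀ {K : Type _} [Field K] [Algebra F K] (a b : K),
      (∀ q ∈ RingHom.ker φ, Polynomial.aeval a q = 0) →
      (∀ q ∈ RingHom.ker φ, Polynomial.aeval b q = 0) → a = b := by
    intro K _ _ a b ha hb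
    let fa : Q →ₐ[F] K := Ideal.Quotient.liftₐ _ (Polynomial.aeval a) ha
    let fb : Q →ₐ[F] K := Ideal.Quotient.liftₐ _ (Polynomial.aeval b) hb
    have := hQ.map (Algebra.TensorProduct.lift fa fb (fun _ _ => Commute.all _ _))
    have h0 := this.eq_zero
    have e1 : fa x = a := (Ideal.Quotient.lift_mk _ _ _).trans (Polynomial.aeval_X a)
    have e2 : fb x = b := (Ideal.Quotient.lift_mk _ _ _).trans (Polynomial.aeval_X b)
    simpa [e1, e2, sub_eq_zero] using h0
  obtain ⟨μ, hμ⟩ := (IsPrincipalIdealRing.principal (RingHom.ker φ)).principal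
  have hμ' : RingHom.ker φ = Ideal.span {μ} := hμ
  have hmem : ∀ {K : Type _} [Field K] [Algebra F K] (a : K), Polynomial.aeval a μ = 0 →
      ∀ q ∈ RingHom.ker φ, Polynomial.aeval a q = 0 := by
    intro K _ _ a ha q hq
    rw [hμ', Ideal.mem_span_singleton] at hq
    obtain ⟨r, rfl⟩ := hq
    simp [ha]
  have hμ0 : μ ≠ 0 := by
    rintro rfl
    exact zero_ne_one (key (0 : F) 1 (hmem _ (by simp)) (hmem _ (by simp)))
  have hμe : Polynomial.aeval e μ = 0 := by
    have : μ ∈ RingHom.ker φ := by rw [hμ']; exact Ideal.mem_span_singleton_self μ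
    exact this
  have hsq : Squarefree μ := by
    have hrad : (RingHom.ker φ).IsRadical := by
      intro q hq
      obtain ⟨k, hk⟩ := hq
      rw [RingHom.mem_ker, map_pow] at hk
      exact eq_zero_of_pow_eq_zero hk
    rw [hμ'] at hrad
    exact (isRadical_iff_span_singleton.2 hrad).squarefree hμ0
  have hsep : μ.Separable := PerfectField.separable_iff_squarefree.2 hsq
  have hdeg : μ.natDegree ≤ 1 := by
    rw [← Polynomial.card_rootSet_eq_natDegree (K := AlgebraicClosure F) hsep
      (IsAlgClosed.splits _)]
    rw [Fintype.card_le_one_iff]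
    rintro ⟨a, ha⟩ ⟨b, hb⟩
    rw [Polynomial.mem_rootSet] at ha hb
    exact Subtype.ext (key a b (hmem _ ha.2) (hmem _ hb.2))
  rw [Polynomial.eq_X_add_C_of_natDegree_le_one hdeg] at hμe hμ0
  simp only [map_add, map_mul, Polynomial.aeval_C, Polynomial.aeval_X] at hμe
  by_cases h1 : μ.coeff 1 = 0
  · rw [h1] at hμe hμ0
    simp only [map_zero, zero_mul, zero_add] at hμe hμ0
    have := (map_eq_zero_iff _ (algebraMap F R).injective).1 hμe
    simp [this] at hμ0
  · refine ⟨-(μ.coeff 1)⁻¹ * μ.coeff 0, ?_⟩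
    have h2 : algebraMap F R (μ.coeff 1)⁻¹ * algebraMap F R (μ.coeff 1) = 1 := by
      rw [← map_mul, inv_mul_cancel₀ h1, map_one]
    rw [map_mul, map_neg]
    linear_combination e * h2 - algebraMap F R (μ.coeff 1)⁻¹ * hμe

open TensorProduct in
/-- Near a minimal prime of a base `C` over `ℂ`, a function on which the two coprojections agree up
to nilpotents is a quotient of elements of `C`. -/
lemma exists_mul_mem_range_of_isNilpotent {C R : Type*} [CommRing C] [CommRing R] [Algebra ℂ C]
    [Algebra C R] [IsReduced R] (hCR : Function.Injective (algebraMap C R))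
    (p : Ideal C) [p.IsPrime] (hp : p ∈ minimalPrimes C) (e : R)
    (h : IsNilpotent ((e ⊗ₜ[C] (1 : R)) - (1 : R) ⊗ₜ[C] e)) :
    ∃ c ∉ p, ∃ c' : C, algebraMap C R c * e = algebraMap C R c' := by
  have hCred : IsReduced C := isReduced_of_injective _ hCR
  let F := Localization.AtPrime p
  let S := Localization (Algebra.algebraMapSubmonoid R p.primeCompl)
  have : IsReduced F := isReduced_localizationPreserves p.primeCompl F hCred
  have : IsReduced S :=
    isReduced_localizationPreserves (Algebra.algebraMapSubmonoid R p.primeCompl) S ‹_›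
  have : Ring.KrullDimLE 0 F := Ring.KrullDimLE.of_isLocalization p hp F
  let : Field F := Ring.KrullDimLE.isField_of_isReduced.toField
  let : Algebra ℂ F := ((algebraMap C F).comp (algebraMap ℂ C)).toAlgebra
  have : CharZero F := charZero_of_injective_algebraMap (algebraMap ℂ F).injective
  have hN : Nontrivial S := by
    rw [← not_subsingleton_iff_nontrivial,
      IsLocalization.subsingleton_iff (S := S) (M := Algebra.algebraMapSubmonoid R p.primeCompl)]
    rintro ⟨c, hc, h0⟩
    rw [← map_zero (algebraMap C R)] at h0
    exact hc (by rw [hCR h0]; exact p.zero_mem)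
  let ι : R →ₐ[C] S := IsScalarTower.toAlgHom C R S
  let Θ : R ⊗[C] R →ₐ[C] S ⊗[F] S := Algebra.TensorProduct.lift
    (((Algebra.TensorProduct.includeLeft : S →ₐ[F] S ⊗[F] S).restrictScalars C).comp ι)
    (((Algebra.TensorProduct.includeRight : S →ₐ[F] S ⊗[F] S).restrictScalars C).comp ι)
    (fun _ _ => Commute.all _ _)
  obtain ⟨x, hx⟩ := mem_range_of_isNilpotent_sub (F := F) (ι e) (by
    simpa [Θ] using h.map Θ)
  obtain ⟨⟨c', c⟩, hc⟩ := IsLocalization.surj p.primeCompl x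
  have h1 : algebraMap R S (algebraMap C R c * e) = algebraMap R S (algebraMap C R c') := by
    have h2 := congrArg (algebraMap F S) hc
    rw [map_mul, hx, ← IsScalarTower.algebraMap_apply C F S,
      ← IsScalarTower.algebraMap_apply C F S, IsScalarTower.algebraMap_apply C R S,
      IsScalarTower.algebraMap_apply C R S] at h2
    rw [map_mul, mul_comm]
    exact h2
  obtain ⟨⟨_, d, hd, rfl⟩, h3⟩ := (IsLocalization.eq_iff_exists
    (Algebra.algebraMapSubmonoid R p.primeCompl) S).1 h1
  refine ⟨d * c, fun h4 => ?_, d * c', ?_⟩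
  · exact (Ideal.IsPrime.mem_or_mem ‹_› h4).elim hd c.2
  · rw [map_mul, map_mul, mul_assoc]
    exact h3

/-- The action of a matrix on polynomial functions by substitution. -/
def act {n : ℕ} (g : Matrix (Fin n) (Fin n) ℂ) :
    MvPolynomial (Fin n) ℂ →ₐ[ℂ] MvPolynomial (Fin n) ℂ :=
  aeval fun i => ∑ j, C (g i j) * X j

@[simp]
lemma eval_act {n : ℕ} (g : Matrix (Fin n) (Fin n) ℂ) (b : MvPolynomial (Fin n) ℂ)
    (v : Fin n → ℂ) : eval v (act g b) = eval (g.mulVec v) b := by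
  induction b using MvPolynomial.induction_on with
  | C a => simp [act]
  | add p q hp hq => simp [hp, hq]
  | mul_X p i hp =>
    rw [map_mul, map_mul, map_mul, hp]
    simp [act, Matrix.mulVec, dotProduct]

lemma act_act {n : ℕ} (g h : Matrix (Fin n) (Fin n) ℂ) (b : MvPolynomial (Fin n) ℂ) :
    act g (act h b) = act (h * g) b :=
  MvPolynomial.funext fun v => by simp [Matrix.mulVec_mulVec]

@[simp]
lemma act_one {n : ℕ} (b : MvPolynomial (Fin n) ℂ) :
    act (1 : Matrix (Fin n) (Fin n) ℂ) b = b :=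
  MvPolynomial.funext fun v => by simp

lemma Invariant.act_eq {n : ℕ} {G : Set (Matrix (Fin n) (Fin n) ℂ)} {p : MvPolynomial (Fin n) ℂ}
    (hp : Invariant ℂ n G p) {g : Matrix (Fin n) (Fin n) ℂ} (hg : g ∈ G) : act g p = p :=
  MvPolynomial.funext fun v => by simp [hp g hg v]

/-- The action of the generic matrix. -/
def genAct {n : ℕ} :
    MvPolynomial (Fin n) ℂ →ₐ[ℂ] MvPolynomial (Fin n) (MvPolynomial (Fin n × Fin n) ℂ) :=
  aeval fun i => ∑ j, C (X (i, j)) * X j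

lemma map_genAct {n : ℕ} (g : Matrix (Fin n) (Fin n) ℂ) (b : MvPolynomial (Fin n) ℂ) :
    map (eval fun ij => g ij.1 ij.2) (genAct b) = act g b := by
  induction b using MvPolynomial.induction_on with
  | C a =>
    have h1 : (genAct (C a) : MvPolynomial (Fin n) (MvPolynomial (Fin n × Fin n) ℂ)) = C (C a) := by
      rw [← MvPolynomial.algebraMap_eq, AlgHom.commutes]; rfl
    have h2 : act g (C a) = C a := by
      rw [← MvPolynomial.algebraMap_eq, AlgHom.commutes]
    simp [h1, h2]
  | add p q hp hq => simp [hp, hq]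
  | mul_X p i hp =>
    rw [map_mul, map_mul, map_mul, hp]
    simp [act, genAct]

lemma act_eq_sum {n : ℕ} (g : Matrix (Fin n) (Fin n) ℂ) (b : MvPolynomial (Fin n) ℂ) :
    act g b = ∑ m ∈ (genAct b).support,
      eval (fun ij => g ij.1 ij.2) (coeff m (genAct b)) • monomial m (1 : ℂ) := by
  conv_lhs => rw [← map_genAct, (genAct b).as_sum, map_sum]
  simp [smul_monomial]

/-- A linear functional evaluated along an orbit is polynomial in the matrix entries. -/
lemma exists_poly_act {n : ℕ} (l : MvPolynomial (Fin n) ℂ →ₗ[ℂ] ℂ) (b : MvPolynomial (Fin n) ℂ) :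
    ∃ r : MvPolynomial (Fin n × Fin n) ℂ, ∀ g : Matrix (Fin n) (Fin n) ℂ,
      eval (fun ij => g ij.1 ij.2) r = l (act g b) := by
  refine ⟨∑ m ∈ (genAct b).support, coeff m (genAct b) * C (l (monomial m 1)), fun g => ?_⟩
  rw [act_eq_sum, map_sum, map_sum]
  simp

/-- The span of an orbit of polynomials. -/
def orbitSpan {n : ℕ} (G : Set (Matrix (Fin n) (Fin n) ℂ)) (f : MvPolynomial (Fin n) ℂ) :
    Submodule ℂ (MvPolynomial (Fin n) ℂ) :=
  Submodule.span ℂ ((fun g => act g f) '' G)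

instance {n : ℕ} (G : Set (Matrix (Fin n) (Fin n) ℂ)) (f : MvPolynomial (Fin n) ℂ) :
    FiniteDimensional ℂ (orbitSpan G f) := by
  classical
  have hle : orbitSpan G f ≤ Submodule.span ℂ
      ((fun m => monomial m (1 : ℂ)) '' ((genAct f).support : Set (Fin n →₀ ℕ))) := by
    rw [orbitSpan, Submodule.span_le]
    rintro _ ⟨g, -, rfl⟩
    simp only [act_eq_sum]
    exact Submodule.sum_mem _ fun m hm => Submodule.smul_mem _ _
      (Submodule.subset_span ⟨m, hm, rfl⟩)
  have : FiniteDimensional ℂ (Submodule.span ℂ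
      ((fun m => monomial m (1 : ℂ)) '' ((genAct f).support : Set (Fin n →₀ ℕ)))) :=
    FiniteDimensional.span_of_finite ℂ (Set.Finite.image _ (Finset.finite_toSet _))
  exact Submodule.finiteDimensional_of_le hle

lemma act_mem_orbitSpan {n : ℕ} {G : Set (Matrix (Fin n) (Fin n) ℂ)} (hG : IsMatSubgroup ℂ n G)
    {f b : MvPolynomial (Fin n) ℂ} (hb : b ∈ orbitSpan G f) {g : Matrix (Fin n) (Fin n) ℂ}
    (hg : g ∈ G) : act g b ∈ orbitSpan G f := by
  refine Submodule.span_induction ?_ ?_ ?_ ?_ hb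
  · rintro _ ⟨h, hh, rfl⟩
    exact Submodule.subset_span ⟨h * g, hG.2.1 h hh g hg, (act_act g h f).symm⟩
  · rw [map_zero]
    exact Submodule.zero_mem _
  · intro x y _ _ hx hy
    rw [map_add]
    exact Submodule.add_mem _ hx hy
  · intro c x _ hx
    rw [map_smul]
    exact Submodule.smul_mem _ c hx

lemma self_mem_orbitSpan {n : ℕ} {G : Set (Matrix (Fin n) (Fin n) ℂ)} (hG : IsMatSubgroup ℂ n G)
    (f : MvPolynomial (Fin n) ℂ) : f ∈ orbitSpan G f :=
  Submodule.subset_span ⟨1, hG.1, by simp⟩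

lemma IsMatSubgroup.mul_inv {n : ℕ} {G : Set (Matrix (Fin n) (Fin n) ℂ)}
    (hG : IsMatSubgroup ℂ n G) {g : Matrix (Fin n) (Fin n) ℂ} (hg : g ∈ G) : g * g⁻¹ = 1 :=
  Matrix.mul_nonsing_inv g ((Matrix.isUnit_iff_isUnit_det g).1 (hG.2.2 g hg).1)

lemma IsMatSubgroup.inv_mul {n : ℕ} {G : Set (Matrix (Fin n) (Fin n) ℂ)}
    (hG : IsMatSubgroup ℂ n G) {g : Matrix (Fin n) (Fin n) ℂ} (hg : g ∈ G) : g⁻¹ * g = 1 :=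
  Matrix.nonsing_inv_mul g ((Matrix.isUnit_iff_isUnit_det g).1 (hG.2.2 g hg).1)

lemma IsMatSubgroup.continuous_coe_inv {n : ℕ} {K : Set (Matrix (Fin n) (Fin n) ℂ)}
    (hK : IsMatSubgroup ℂ n K) : Continuous fun a : K => (a : Matrix (Fin n) (Fin n) ℂ)⁻¹ := by
  simp only [Matrix.inv_def, Ring.inverse_eq_inv']
  refine Continuous.smul (Continuous.inv₀ continuous_subtype_val.matrix_det fun a => ?_)
    continuous_subtype_val.matrix_adjugate
  exact ((Matrix.isUnit_iff_isUnit_det _).1 (hK.2.2 _ a.2).1).ne_zero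

/-- A compact matrix group carries a normalised right-invariant mean on continuous functions. -/
lemma exists_invariant_mean {n : ℕ} {K : Set (Matrix (Fin n) (Fin n) ℂ)} (hK : IsCompact K)
    (hKG : IsMatSubgroup ℂ n K) :
    ∃ J : C(K, ℂ) →ₗ[ℂ] ℂ, J 1 = 1 ∧ ∀ k₀ ∈ K, ∀ f f' : C(K, ℂ),
      (∀ k k' : K, (k' : Matrix (Fin n) (Fin n) ℂ) = k * k₀ → f' k = f k') → J f' = J f := by
  classical
  let : Group K :=
    { mul := fun a b => ⟨a * b, hKG.2.1 _ a.2 _ b.2⟩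
      one := ⟨1, hKG.1⟩
      inv := fun a => ⟨(a : Matrix (Fin n) (Fin n) ℂ)⁻¹, (hKG.2.2 _ a.2).2⟩
      mul_assoc := fun a b c => Subtype.ext (mul_assoc _ _ _)
      one_mul := fun a => Subtype.ext (one_mul _)
      mul_one := fun a => Subtype.ext (mul_one _)
      inv_mul_cancel := fun a => Subtype.ext (hKG.inv_mul a.2) }
  have : ContinuousMul K := ⟨by
    rw [continuous_induced_rng]
    exact (continuous_subtype_val.comp continuous_fst).mul
      (continuous_subtype_val.comp continuous_snd)⟩
  have : ContinuousInv K := ⟨by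
    rw [continuous_induced_rng]
    exact hKG.continuous_coe_inv⟩
  have : IsTopologicalGroup K := ⟨⟩
  have : CompactSpace K := isCompact_iff_compactSpace.1 hK
  let : MeasurableSpace K := borel K
  have : BorelSpace K := ⟨rfl⟩
  let μ : MeasureTheory.Measure K := MeasureTheory.Measure.haar
  have hint : ∀ f : C(K, ℂ), MeasureTheory.Integrable f μ := fun f =>
    f.continuous.integrable_of_hasCompactSupport (HasCompactSupport.of_compactSpace f)
  let ν : C(K, K) := ⟨fun k => k⁻¹, continuous_inv⟩
  let I : C(K, ℂ) →ₗ[ℂ] ℂ :=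
    { toFun := fun f => ∫ k, f k⁻¹ ∂μ
      map_add' := fun f g => MeasureTheory.integral_add (hint (f.comp ν)) (hint (g.comp ν))
      map_smul' := fun c f => MeasureTheory.integral_const_mul c _ }
  have hI1 : I 1 ≠ 0 := by
    change (∫ k : K, (1 : ℂ) ∂μ) ≠ 0
    simp [MeasureTheory.measureReal_def, ENNReal.toReal_eq_zero_iff, NeZero.ne μ]
  refine ⟨(I 1)⁻¹ • I, by simp [hI1], fun k₀ hk₀ f f' hff' => ?_⟩
  have : I f' = I f := by
    have h1 : ∀ k, f' k⁻¹ = f ((⟨k₀, hk₀⟩⁻¹ * k)⁻¹) := fun k => by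
      rw [mul_inv_rev, inv_inv]
      exact hff' _ _ rfl
    change (∫ k, f' k⁻¹ ∂μ) = ∫ k, f k⁻¹ ∂μ
    simp only [h1]
    exact MeasureTheory.integral_mul_left_eq_self (fun k => f k⁻¹) _
  simp [this]

/-- The vector `p` is the mean of the vector-valued function `F`, tested against functionals. -/
def IsMean {κ E : Type*} [TopologicalSpace κ] [AddCommGroup E] [Module ℂ E]
    (J : C(κ, ℂ) →ₗ[ℂ] ℂ) (F : κ → E) (p : E) : Prop :=
  ∀ l : E →ₗ[ℂ] ℂ, ∃ f : C(κ, ℂ), (∀ k, f k = l (F k)) ∧ l p = J f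

lemma IsMean.smul_const {κ E : Type*} [TopologicalSpace κ] [AddCommGroup E] [Module ℂ E]
    (J : C(κ, ℂ) →ₗ[ℂ] ℂ) {c : κ → ℂ} (hc : Continuous c) (x : E) :
    IsMean J (fun k => c k • x) (J ⟨c, hc⟩ • x) := fun l =>
  ⟨l x • ⟨c, hc⟩, fun k => by simp [mul_comm], by simp [mul_comm]⟩

lemma IsMean.sum {κ E ι : Type*} [TopologicalSpace κ] [AddCommGroup E] [Module ℂ E]
    {J : C(κ, ℂ) →ₗ[ℂ] ℂ} {s : Finset ι} {F : ι → κ → E} {p : ι → E}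
    (h : ∀ i, IsMean J (F i) (p i)) :
    IsMean J (fun k => ∑ i ∈ s, F i k) (∑ i ∈ s, p i) := by
  intro l
  choose f hf hp using fun i => h i l
  exact ⟨∑ i ∈ s, f i, fun k => by simp [ContinuousMap.sum_apply, hf], by simp [hp]⟩

lemma IsMean.eq_const {κ E : Type*} [TopologicalSpace κ] [AddCommGroup E] [Module ℂ E]
    {J : C(κ, ℂ) →ₗ[ℂ] ℂ} (hJ : J 1 = 1) {F : κ → E} {p : E} (h : IsMean J F p)
    (l : E →ₗ[ℂ] ℂ) (c : ℂ) (hF : ∀ k, l (F k) = c) : l p = c := by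
  obtain ⟨f, hf, hp⟩ := h l
  have : f = c • 1 := by ext k; simp [hf, hF]
  rw [hp, this, map_smul, hJ, smul_eq_mul, mul_one]

lemma IsMean.mem {κ E : Type*} [TopologicalSpace κ] [AddCommGroup E] [Module ℂ E]
    {J : C(κ, ℂ) →ₗ[ℂ] ℂ} (hJ : J 1 = 1) {F : κ → E} {p : E} (h : IsMean J F p)
    (S : Submodule ℂ E) (hF : ∀ k, F k ∈ S) : p ∈ S := by
  by_contra hp
  obtain ⟨l, hl, hS⟩ := Submodule.exists_le_ker_of_notMem hp
  exact hl (h.eq_const hJ l 0 fun k => hS (hF k))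

lemma continuous_eval_matrix {κ : Type*} [TopologicalSpace κ] {n : ℕ}
    {u : κ → Matrix (Fin n) (Fin n) ℂ} (hu : Continuous u) (r : MvPolynomial (Fin n × Fin n) ℂ) :
    Continuous fun k => eval (fun ij => u k ij.1 ij.2) r :=
  (MvPolynomial.continuous_eval r).comp
    (continuous_pi fun ij => (continuous_apply ij.2).comp ((continuous_apply ij.1).comp hu))

lemma exists_isMean_act {n : ℕ} {K : Set (Matrix (Fin n) (Fin n) ℂ)} (J : C(K, ℂ) →ₗ[ℂ] ℂ)
    (b : MvPolynomial (Fin n) ℂ) : ∃ p, IsMean J (fun k => act (k : Matrix _ _ ℂ) b) p := by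
  simp only [act_eq_sum]
  exact ⟨_, IsMean.sum fun m =>
    IsMean.smul_const J (continuous_eval_matrix continuous_subtype_val _) _⟩

lemma exists_isMean_conj {n : ℕ} {K : Set (Matrix (Fin n) (Fin n) ℂ)} (hK : IsMatSubgroup ℂ n K)
    (J : C(K, ℂ) →ₗ[ℂ] ℂ) (Φ : MvPolynomial (Fin n) ℂ →ₗ[ℂ] MvPolynomial (Fin n) ℂ)
    (b : MvPolynomial (Fin n) ℂ) :
    ∃ p, IsMean J (fun k => act (k : Matrix _ _ ℂ) (Φ (act (k : Matrix _ _ ℂ)⁻¹ b))) p := by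
  have : ∀ k : K, act (k : Matrix _ _ ℂ) (Φ (act (k : Matrix _ _ ℂ)⁻¹ b)) =
      ∑ m ∈ (genAct b).support, ∑ m' ∈ (genAct (Φ (monomial m 1))).support,
        (eval (fun ij => (k : Matrix _ _ ℂ)⁻¹ ij.1 ij.2) (coeff m (genAct b)) *
          eval (fun ij => (k : Matrix _ _ ℂ) ij.1 ij.2) (coeff m' (genAct (Φ (monomial m 1))))) •
            monomial m' (1 : ℂ) := fun k => by
    rw [act_eq_sum (k : Matrix _ _ ℂ)⁻¹ b, map_sum, map_sum]
    refine Finset.sum_congr rfl fun m _ => ?_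
    rw [map_smul, map_smul, act_eq_sum, Finset.smul_sum]
    exact Finset.sum_congr rfl fun m' _ => smul_smul _ _ _
  simp only [this]
  exact ⟨_, IsMean.sum fun m => IsMean.sum fun m' => IsMean.smul_const J
    ((continuous_eval_matrix hK.continuous_coe_inv _).mul
      (continuous_eval_matrix continuous_subtype_val _)) _⟩

/-- Averaging a polynomial over a reductive group. -/
lemma exists_invariant_average {n : ℕ} {G : Set (Matrix (Fin n) (Fin n) ℂ)}
    (hG : IsReductiveGroup ℂ n G) (b : MvPolynomial (Fin n) ℂ) :
    ∃ p, Invariant ℂ n G p ∧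
      (∀ S : Submodule ℂ (MvPolynomial (Fin n) ℂ), (∀ g ∈ G, act g b ∈ S) → p ∈ S) ∧
      ∀ v c, (∀ g ∈ G, eval (g.mulVec v) b = c) → eval v p = c := by
  obtain ⟨-, -, K, hKG, hKc, hK, hKd⟩ := hG
  obtain ⟨J, hJ1, hJ⟩ := exists_invariant_mean hKc hK
  obtain ⟨p, hp⟩ := exists_isMean_act J b
  refine ⟨p, fun g hg v => ?_, fun S hS => hp.mem hJ1 S fun k => hS _ (hKG k.2),
    fun v c h => hp.eq_const hJ1 (aeval v).toLinearMap c fun k => ?_⟩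
  · have key : ∀ k ∈ K, eval (k.mulVec v) p = eval v p := by
      intro k hk
      have hp' : ∀ v, ∃ f : C(K, ℂ), (∀ k : K, f k = eval ((k : Matrix _ _ ℂ).mulVec v) b) ∧
          eval v p = J f := fun v => by simpa using hp (aeval v).toLinearMap
      obtain ⟨f, hf, hfp⟩ := hp' v
      obtain ⟨f', hf', hfp'⟩ := hp' (k.mulVec v)
      rw [hfp, hfp']
      refine hJ k hk _ _ fun k₁ k₂ h => ?_
      rw [hf, hf', h, Matrix.mulVec_mulVec]
    obtain ⟨r, hr⟩ := exists_poly_act (aeval v).toLinearMap p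
    have := hKd (r - C (eval v p)) (fun k hk => by simpa [hr, sub_eq_zero] using key k hk) g hg
    simpa [hr, sub_eq_zero] using this
  · simpa using h k (hKG k.2)

/-- Averaging a linear endomorphism of the polynomial ring over a reductive group. -/
lemma exists_equivariant_average {n : ℕ} {G : Set (Matrix (Fin n) (Fin n) ℂ)}
    (hG : IsReductiveGroup ℂ n G) (Φ₀ : MvPolynomial (Fin n) ℂ →ₗ[ℂ] MvPolynomial (Fin n) ℂ) :
    ∃ Φ : MvPolynomial (Fin n) ℂ →ₗ[ℂ] MvPolynomial (Fin n) ℂ,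
      (∀ g ∈ G, ∀ b, Φ (act g b) = act g (Φ b)) ∧
      ∀ b v c, (∀ g ∈ G, eval (g.mulVec v) (Φ₀ (act g⁻¹ b)) = c) → eval v (Φ b) = c := by
  obtain ⟨-, -, K, hKG, hKc, hK, hKd⟩ := hG
  obtain ⟨J, hJ1, hJ⟩ := exists_invariant_mean hKc hK
  choose P hP using exists_isMean_conj hK J Φ₀
  have hP' : ∀ v b, ∃ f : C(K, ℂ), (∀ k : K, f k = eval ((k : Matrix _ _ ℂ).mulVec v)
      (Φ₀ (act (k : Matrix _ _ ℂ)⁻¹ b))) ∧ eval v (P b) = J f := fun v b => by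
    simpa using hP b (aeval v).toLinearMap
  let Φ : MvPolynomial (Fin n) ℂ →ₗ[ℂ] MvPolynomial (Fin n) ℂ :=
    { toFun := P
      map_add' := fun b b' => MvPolynomial.funext fun v => by
        obtain ⟨f₁, hf₁, h₁⟩ := hP' v b
        obtain ⟨f₂, hf₂, h₂⟩ := hP' v b'
        obtain ⟨f₃, hf₃, h₃⟩ := hP' v (b + b')
        rw [map_add, h₁, h₂, h₃, ← map_add]
        congr 1
        ext k
        simp [hf₁, hf₂, hf₃]
      map_smul' := fun c b => MvPolynomial.funext fun v => by
        obtain ⟨f₁, hf₁, h₁⟩ := hP' v b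
        obtain ⟨f₃, hf₃, h₃⟩ := hP' v (c • b)
        rw [RingHom.id_apply, smul_eval, h₁, h₃, ← smul_eq_mul, ← map_smul]
        congr 1
        ext k
        simp [hf₁, hf₃] }
  refine ⟨Φ, fun g hg b => MvPolynomial.funext fun v => ?_,
    fun b v c h => (hP b).eq_const hJ1 (aeval v).toLinearMap c fun k => ?_⟩
  · have key : ∀ k ∈ K, eval v (Φ (act k b)) = eval v (act k (Φ b)) := by
      intro k hk
      obtain ⟨f, hf, hfp⟩ := hP' (k.mulVec v) b
      obtain ⟨f', hf', hfp'⟩ := hP' v (act k b)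
      change eval v (P (act k b)) = eval v (act k (P b))
      rw [eval_act, hfp, hfp']
      symm
      refine hJ k hk _ _ fun k₁ k₂ h => ?_
      rw [hf, hf', h, Matrix.mulVec_mulVec, act_act, Matrix.mul_inv_rev, ← mul_assoc,
        hK.mul_inv hk, one_mul]
    obtain ⟨r, hr⟩ := exists_poly_act ((aeval v).toLinearMap ∘ₗ Φ) b
    obtain ⟨s, hs⟩ := exists_poly_act (aeval v).toLinearMap (Φ b)
    have := hKd (r - s) (fun k hk => by simpa [hr, hs, sub_eq_zero] using key k hk) g hg
    simpa [hr, hs, sub_eq_zero] using this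
  · simpa using h k (hKG k.2)

lemma exists_algHom_of_isMaximal {T : Type*} [CommRing T] [Algebra ℂ T] [Algebra.FiniteType ℂ T]
    (m : Ideal T) [m.IsMaximal] : ∃ χ : T →ₐ[ℂ] ℂ, ∀ t, χ t = 0 → t ∈ m := by
  let : Field (T ⧸ m) := Ideal.Quotient.field m
  have : Algebra.FiniteType ℂ (T ⧸ m) :=
    Algebra.FiniteType.of_surjective (Ideal.Quotient.mkₐ ℂ m) (Ideal.Quotient.mkₐ_surjective ℂ m)
  have : Module.Finite ℂ (T ⧸ m) := finite_of_finite_type_of_isJacobsonRing ℂ (T ⧸ m)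
  let ε := AlgEquiv.ofBijective (Algebra.ofId ℂ (T ⧸ m))
    (IsAlgClosed.algebraMap_bijective_of_isIntegral (k := ℂ) (K := T ⧸ m))
  refine ⟨(ε.symm : (T ⧸ m) →ₐ[ℂ] ℂ).comp (Ideal.Quotient.mkₐ ℂ m), fun t ht => ?_⟩
  have h : ε.symm (Ideal.Quotient.mk m t) = 0 := ht
  rw [EmbeddingLike.map_eq_zero_iff] at h
  exact Ideal.Quotient.eq_zero_iff_mem.1 h

/-- An element of a finitely generated complex algebra killed by all characters is nilpotent. -/
lemma isNilpotent_of_forall_algHom {T : Type*} [CommRing T] [Algebra ℂ T] [Algebra.FiniteType ℂ T]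
    (t : T) (h : ∀ χ : T →ₐ[ℂ] ℂ, χ t = 0) : IsNilpotent t := by
  have : IsJacobsonRing T := isJacobsonRing_of_finiteType (A := ℂ)
  rw [← mem_nilradical, nilradical, Ideal.radical_eq_jacobson, Ideal.zero_eq_bot,
    Ideal.mem_jacobson_bot]
  intro s
  by_contra hu
  obtain ⟨m, hm, hmem⟩ := exists_max_ideal_of_mem_nonunits hu
  obtain ⟨χ, hχ⟩ := exists_algHom_of_isMaximal m
  refine hm.ne_top ((Ideal.eq_top_iff_one m).2 ?_)
  have ht : t ∈ m := hχ t (h χ)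
  simpa using m.sub_mem hmem (m.mul_mem_right s ht)

lemma exists_zero_of_ne_top {n : ℕ} {I : Ideal (MvPolynomial (Fin n) ℂ)} (hI : I ≠ ⊤) :
    ∃ v, ∀ p ∈ I, eval v p = 0 := by
  obtain ⟨m, hm, hle⟩ := Ideal.exists_le_maximal I hI
  obtain ⟨v, rfl⟩ := MvPolynomial.isMaximal_iff_eq_vanishingIdeal_singleton.1 hm
  exact ⟨v, fun p hp => by
    simpa using (MvPolynomial.mem_vanishingIdeal_singleton_iff v p).1 (hle hp)⟩

/-- A stable ideal with a non-zero on a closed orbit is comaximal with the ideal of the orbit. -/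
lemma sup_vanishingIdeal_orbit_eq_top {n : ℕ} {G : Set (Matrix (Fin n) (Fin n) ℂ)}
    (hG : IsMatSubgroup ℂ n G) {y : Fin n → ℂ} (hy : HasClosedOrbit ℂ n G y)
    (I : Ideal (MvPolynomial (Fin n) ℂ)) (hI : ∀ g ∈ G, ∀ q ∈ I, act g q ∈ I)
    {q : MvPolynomial (Fin n) ℂ} (hq : q ∈ I) {g₀ : Matrix (Fin n) (Fin n) ℂ} (hg₀ : g₀ ∈ G)
    (hq0 : eval (g₀.mulVec y) q ≠ 0) :
    I ⊔ ZPaper.vanishingIdeal ℂ n (orbit ℂ n G y) = ⊤ := by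
  by_contra hne
  obtain ⟨v, hv⟩ := exists_zero_of_ne_top hne
  obtain ⟨g, hg, rfl⟩ : v ∈ orbit ℂ n G y :=
    hy fun p hp => hv p ((le_sup_right : _ ≤ I ⊔ _) hp)
  have := hv _ ((le_sup_left : I ≤ I ⊔ _)
    (hI (g₀ * g⁻¹) (hG.2.1 _ hg₀ _ (hG.2.2 g hg).2) q hq))
  rw [eval_act, Matrix.mulVec_mulVec, mul_assoc, hG.inv_mul hg, mul_one] at this
  exact hq0 this

/-- The regular functions on a matrix group. -/
def regularFunctions {n : ℕ} (G : Set (Matrix (Fin n) (Fin n) ℂ)) : Subalgebra ℂ (G → ℂ) :=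
  Algebra.adjoin ℂ (Set.range (fun (ij : Fin n × Fin n) (g : G) =>
      (g : Matrix (Fin n) (Fin n) ℂ) ij.1 ij.2) ∪
    {fun g : G => (g : Matrix (Fin n) (Fin n) ℂ).det⁻¹})

instance {n : ℕ} (G : Set (Matrix (Fin n) (Fin n) ℂ)) :
    Algebra.FiniteType ℂ (regularFunctions G) :=
  .adjoin_of_finite ((Set.finite_range _).union (Set.finite_singleton _))

/-- The restriction of a polynomial in the matrix entries to the group. -/
def regularOfPoly {n : ℕ} (G : Set (Matrix (Fin n) (Fin n) ℂ)) :
    MvPolynomial (Fin n × Fin n) ℂ →ₐ[ℂ] regularFunctions G :=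
  aeval fun ij => ⟨fun g => (g : Matrix (Fin n) (Fin n) ℂ) ij.1 ij.2,
    Algebra.subset_adjoin (Or.inl ⟨ij, rfl⟩)⟩

lemma regularOfPoly_apply {n : ℕ} (G : Set (Matrix (Fin n) (Fin n) ℂ))
    (r : MvPolynomial (Fin n × Fin n) ℂ) (g : G) :
    (regularOfPoly G r : G → ℂ) g =
      eval (fun ij => (g : Matrix (Fin n) (Fin n) ℂ) ij.1 ij.2) r := by
  have : ((Pi.evalAlgHom ℂ (fun _ : G => ℂ) g).comp (regularFunctions G).val).comp
      (regularOfPoly G) = aeval (fun ij => (g : Matrix (Fin n) (Fin n) ℂ) ij.1 ij.2) := by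
    ext ij
    simp [regularOfPoly]
  simpa using DFunLike.congr_fun this r

/-- Characters of the ring of regular functions are evaluations. -/
lemma exists_eq_eval_of_algHom {n : ℕ} {G : Set (Matrix (Fin n) (Fin n) ℂ)}
    (hG : IsMatSubgroup ℂ n G) (hGZ : IsZClosedInGL ℂ n G) (χ : regularFunctions G →ₐ[ℂ] ℂ) :
    ∃ g : G, ∀ r, χ (regularOfPoly G r) = (regularOfPoly G r : G → ℂ) g := by
  obtain ⟨P, hP⟩ := hGZ
  let g₀ : Matrix (Fin n) (Fin n) ℂ := Matrix.of fun i j => χ (regularOfPoly G (X (i, j)))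
  have hχ : ∀ r, χ (regularOfPoly G r) = eval (fun ij => g₀ ij.1 ij.2) r := by
    have : χ.comp (regularOfPoly G) = aeval (fun ij => g₀ ij.1 ij.2) := by
      ext ij
      simp [g₀]
    intro r
    simpa using DFunLike.congr_fun this r
  have hg₀ : g₀ ∈ G := by
    rw [hP]
    refine ⟨?_, fun p hp => ?_⟩
    · rw [Matrix.isUnit_iff_isUnit_det, isUnit_iff_ne_zero]
      intro h0
      let d : MvPolynomial (Fin n × Fin n) ℂ := (Matrix.of fun i j => X (i, j)).det
      have hd : ∀ g : Matrix (Fin n) (Fin n) ℂ, eval (fun ij => g ij.1 ij.2) d = g.det := by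
        intro g
        rw [RingHom.map_det]
        congr 1
        ext i j
        simp
      let δ : regularFunctions G := ⟨fun g : G => (g : Matrix (Fin n) (Fin n) ℂ).det⁻¹,
        Algebra.subset_adjoin (Or.inr rfl)⟩
      have h1 : regularOfPoly G d * δ = 1 := by
        ext g
        have := ((Matrix.isUnit_iff_isUnit_det _).1 (hG.2.2 _ g.2).1).ne_zero
        simp [δ, regularOfPoly_apply, hd, this]
      have := congrArg χ h1
      simp [hχ, hd, h0] at this
    · have : regularOfPoly G p = 0 := by
        ext g
        simpa [regularOfPoly_apply] using (hP.subset g.2).2 p hp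
      rw [← hχ, this, map_zero]
  exact ⟨⟨g₀, hg₀⟩, fun r => by rw [hχ, regularOfPoly_apply]⟩

open TensorProduct in
/-- A function constant on the fibres of `Spec R → Spec C`, tested on complex points, agrees up to
nilpotents under the two coprojections to the tensor square. -/
lemma isNilpotent_tmul_sub {C R : Type*} [CommRing C] [CommRing R] [Algebra ℂ C]
    [Algebra ℂ R] [Algebra C R] [IsScalarTower ℂ C R] [Algebra.FiniteType ℂ R] (e : R)
    (h : ∀ χ χ' : R →ₐ[ℂ] ℂ, (∀ c, χ (algebraMap C R c) = χ' (algebraMap C R c)) → χ e = χ' e) :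
    IsNilpotent ((e ⊗ₜ[C] (1 : R)) - (1 : R) ⊗ₜ[C] e) := by
  have : Algebra.FiniteType C R := Algebra.FiniteType.of_restrictScalars_finiteType ℂ C R
  have : Algebra.FiniteType R (R ⊗[C] R) := Algebra.FiniteType.baseChange R
  have : Algebra.FiniteType ℂ (R ⊗[C] R) := Algebra.FiniteType.trans (S := R) inferInstance this
  refine isNilpotent_of_forall_algHom _ fun χ => ?_
  let χ₁ : R →ₐ[ℂ] ℂ := χ.comp
    ((Algebra.TensorProduct.includeLeft : R →ₐ[C] R ⊗[C] R).restrictScalars ℂ)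
  let χ₂ : R →ₐ[ℂ] ℂ := χ.comp
    ((Algebra.TensorProduct.includeRight : R →ₐ[C] R ⊗[C] R).restrictScalars ℂ)
  have := h χ₁ χ₂ fun c => by
    simp only [χ₁, χ₂, AlgHom.comp_apply, AlgHom.restrictScalars_apply, AlgHom.commutes]
  rw [map_sub, sub_eq_zero]
  exact this

/-- Near a minimal prime of the base, a function constant on fibres is a quotient of elements of
the base. -/
lemma exists_mul_mem_of_forall_algHom {R : Type*} [CommRing R] [Algebra ℂ R] [IsReduced R]
    [Algebra.FiniteType ℂ R] (S : Subalgebra ℂ R) (p : Ideal S) (hp : p ∈ minimalPrimes S) (e : R)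
    (h : ∀ χ χ' : R →ₐ[ℂ] ℂ, (∀ c ∈ S, χ c = χ' c) → χ e = χ' e) :
    ∃ c : S, c ∉ p ∧ (c : R) * e ∈ S := by
  have : p.IsPrime := hp.1.1
  obtain ⟨c, hc, c', h⟩ := exists_mul_mem_range_of_isNilpotent (C := S) (R := R)
    Subtype.val_injective p hp e (isNilpotent_tmul_sub e fun χ χ' h' =>
      h χ χ' fun c hc => h' ⟨c, hc⟩)
  exact ⟨c, hc, h ▸ c'.2⟩

lemma exists_mul_mem_of_finset {R : Type*} [CommRing R] [Algebra ℂ R] (S : Subalgebra ℂ R)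
    (p : Ideal S) [p.IsPrime] {ι : Type*} (t : Finset ι) (e : ι → R)
    (h : ∀ i ∈ t, ∃ c : S, c ∉ p ∧ (c : R) * e i ∈ S) :
    ∃ c : S, c ∉ p ∧ ∀ i ∈ t, (c : R) * e i ∈ S := by
  classical
  induction t using Finset.induction_on with
  | empty => exact ⟨1, Ideal.IsPrime.one_notMem ‹_›, by simp⟩
  | insert b t _ ih =>
    obtain ⟨c, hc, hct⟩ := ih fun i hi => h i (Finset.mem_insert_of_mem hi)
    obtain ⟨d, hd, hdb⟩ := h b (Finset.mem_insert_self _ _)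
    refine ⟨c * d, fun h => (Ideal.IsPrime.mem_or_mem ‹_› h).elim hc hd, fun b' hb' => ?_⟩
    rcases Finset.mem_insert.1 hb' with rfl | hb'
    · rw [MulMemClass.coe_mul, mul_assoc]
      exact mul_mem c.2 hdb
    · rw [MulMemClass.coe_mul, mul_right_comm]
      exact mul_mem (hct b' hb') d.2

/-- Functions constant on fibres are quotients of functions of the base with a common
denominator. -/
lemma exists_ne_zero_mul_mem {R : Type*} [CommRing R] [Nontrivial R] [Algebra ℂ R] [IsReduced R]
    [Algebra.FiniteType ℂ R] (S : Subalgebra ℂ R) {ι : Type*} (t : Finset ι) (e : ι → R)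
    (h : ∀ i ∈ t, ∀ χ χ' : R →ₐ[ℂ] ℂ, (∀ c ∈ S, χ c = χ' c) → χ (e i) = χ' (e i)) :
    ∃ c ∈ S, c ≠ 0 ∧ ∀ i ∈ t, c * e i ∈ S := by
  obtain ⟨p, hp⟩ := Ideal.nonempty_minimalPrimes (I := (⊥ : Ideal S)) bot_ne_top
  have hpp : p.IsPrime := hp.1.1
  obtain ⟨c, hc, hct⟩ := exists_mul_mem_of_finset S p t e fun i hi =>
    exists_mul_mem_of_forall_algHom S p hp (e i) (h i hi)
  refine ⟨c, c.2, fun h0 => hc ?_, hct⟩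
  have : c = 0 := Subtype.ext h0
  rw [this]
  exact p.zero_mem

/-- Restrictions of polynomials to an orbit, as regular functions on the group. -/
def orbitFunctions {n : ℕ} (G : Set (Matrix (Fin n) (Fin n) ℂ)) (y : Fin n → ℂ) :
    Subalgebra ℂ (regularFunctions G) where
  carrier := {c | ∃ q, ∀ g : G, (c : G → ℂ) g = eval ((g : Matrix (Fin n) (Fin n) ℂ).mulVec y) q}
  add_mem' := fun ⟨p, hp⟩ ⟨q, hq⟩ => ⟨p + q, fun g => by simp [hp, hq]⟩
  mul_mem' := fun ⟨p, hp⟩ ⟨q, hq⟩ => ⟨p * q, fun g => by simp [hp, hq]⟩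
  algebraMap_mem' := fun c => ⟨C c, fun g => by simp⟩

lemma eq_of_forall_orbitFunctions {n : ℕ} {G : Set (Matrix (Fin n) (Fin n) ℂ)}
    (hG : IsMatSubgroup ℂ n G) (hGZ : IsZClosedInGL ℂ n G) {y : Fin n → ℂ}
    {r : MvPolynomial (Fin n × Fin n) ℂ}
    (hr : ∀ g ∈ G, ∀ h ∈ isotropy ℂ n G y,
      eval (fun ij => (g * h) ij.1 ij.2) r = eval (fun ij => g ij.1 ij.2) r)
    (χ χ' : regularFunctions G →ₐ[ℂ] ℂ) (h : ∀ c ∈ orbitFunctions G y, χ c = χ' c) :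
    χ (regularOfPoly G r) = χ' (regularOfPoly G r) := by
  obtain ⟨g, hg⟩ := exists_eq_eval_of_algHom hG hGZ χ
  obtain ⟨g', hg'⟩ := exists_eq_eval_of_algHom hG hGZ χ'
  have hgy : (g : Matrix (Fin n) (Fin n) ℂ).mulVec y =
      (g' : Matrix (Fin n) (Fin n) ℂ).mulVec y := by
    ext i
    obtain ⟨s, hs⟩ := exists_poly_act (aeval y).toLinearMap (X i)
    have hs' : ∀ g : G, (regularOfPoly G s : G → ℂ) g =
        eval ((g : Matrix (Fin n) (Fin n) ℂ).mulVec y) (X i) := fun g => by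
      rw [regularOfPoly_apply, hs]
      simp
    have := h _ ⟨X i, hs'⟩
    rwa [hg, hg', hs', hs', eval_X, eval_X] at this
  have hiso : (g : Matrix (Fin n) (Fin n) ℂ)⁻¹ * g' ∈ isotropy ℂ n G y := by
    refine ⟨hG.2.1 _ (hG.2.2 _ g.2).2 _ g'.2, ?_⟩
    rw [← Matrix.mulVec_mulVec, ← hgy, Matrix.mulVec_mulVec, hG.inv_mul g.2, Matrix.one_mulVec]
  have := hr _ g.2 _ hiso
  rw [← mul_assoc, hG.mul_inv g.2, one_mul] at this
  rw [hg, hg', regularOfPoly_apply, regularOfPoly_apply, this]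

/-- Isotropy-invariant functionals are quotients of functions on the orbit, with a common
denominator. -/
lemma exists_denominator {n : ℕ} {G : Set (Matrix (Fin n) (Fin n) ℂ)}
    (hG : IsMatSubgroup ℂ n G) (hGZ : IsZClosedInGL ℂ n G) {y : Fin n → ℂ}
    (t : Finset (MvPolynomial (Fin n) ℂ)) (l : MvPolynomial (Fin n) ℂ →ₗ[ℂ] ℂ)
    (hl : ∀ g ∈ G, ∀ h ∈ isotropy ℂ n G y, ∀ b ∈ t, l (act (g * h) b) = l (act g b)) :
    ∃ q : MvPolynomial (Fin n) ℂ, (∃ g ∈ G, eval (g.mulVec y) q ≠ 0) ∧ ∀ b ∈ t, ∃ b',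
      ∀ g ∈ G, eval (g.mulVec y) b' = eval (g.mulVec y) q * l (act g b) := by
  classical
  have : Nonempty G := ⟨⟨1, hG.1⟩⟩
  have : IsReduced (regularFunctions G) :=
    isReduced_of_injective (regularFunctions G).val Subtype.val_injective
  choose r hr using exists_poly_act l
  have hr' : ∀ b ∈ t, ∀ g ∈ G, ∀ h ∈ isotropy ℂ n G y,
      eval (fun ij => (g * h) ij.1 ij.2) (r b) = eval (fun ij => g ij.1 ij.2) (r b) := by
    intro b hb g hg h hh
    rw [hr b (g * h), hr b g]
    exact hl g hg h hh b hb
  obtain ⟨c, ⟨q, hq⟩, hc, hct⟩ := exists_ne_zero_mul_mem (orbitFunctions G y) t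
    (fun b => regularOfPoly G (r b)) fun b hb =>
      eq_of_forall_orbitFunctions hG hGZ (r := r b) (hr' b hb)
  refine ⟨q, ?_, fun b hb => ?_⟩
  · by_contra! h0
    refine hc (Subtype.ext (funext fun g => ?_))
    rw [hq g, h0 g g.2, ZeroMemClass.coe_zero, Pi.zero_apply]
  · obtain ⟨b', hb'⟩ := hct b hb
    exact ⟨b', fun g hg => by
      rw [← hb' ⟨g, hg⟩, ← hq ⟨g, hg⟩, ← hr, ← regularOfPoly_apply G (r b) ⟨g, hg⟩]
      rfl⟩

/-- An isotropy-invariant functional on a finite-dimensional stable space of polynomials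
extends, as a function on a closed orbit, to a polynomial. -/
lemma exists_poly_eq_functional {n : ℕ} {G : Set (Matrix (Fin n) (Fin n) ℂ)}
    (hG : IsMatSubgroup ℂ n G) (hGZ : IsZClosedInGL ℂ n G) {y : Fin n → ℂ}
    (hy : HasClosedOrbit ℂ n G y) (W : Submodule ℂ (MvPolynomial (Fin n) ℂ))
    [FiniteDimensional ℂ W] (hW : ∀ g ∈ G, ∀ b ∈ W, act g b ∈ W)
    (l : MvPolynomial (Fin n) ℂ →ₗ[ℂ] ℂ)
    (hl : ∀ h ∈ isotropy ℂ n G y, ∀ b ∈ W, l (act h b) = l b) :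
    ∀ b ∈ W, ∃ b', ∀ g ∈ G, eval (g.mulVec y) b' = l (act g b) := by
  classical
  let I : Ideal (MvPolynomial (Fin n) ℂ) :=
    { carrier := {q | ∀ b ∈ W, ∃ b', ∀ g ∈ G,
        eval (g.mulVec y) b' = eval (g.mulVec y) q * l (act g b)}
      zero_mem' := fun b _ => ⟨0, by simp⟩
      add_mem' := fun {p q} hp hq b hb => by
        obtain ⟨b₁, h₁⟩ := hp b hb
        obtain ⟨b₂, h₂⟩ := hq b hb
        exact ⟨b₁ + b₂, fun g hg => by rw [map_add, map_add, h₁ g hg, h₂ g hg, add_mul]⟩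
      smul_mem' := fun c q hq b hb => by
        obtain ⟨b₁, h₁⟩ := hq b hb
        exact ⟨c * b₁, fun g hg => by
          rw [map_mul, h₁ g hg, smul_eq_mul, map_mul, mul_assoc]⟩ }
  have hIst : ∀ g ∈ G, ∀ q ∈ I, act g q ∈ I := by
    intro h hh q hq b hb
    obtain ⟨b', hb'⟩ := hq (act h⁻¹ b) (hW _ (hG.2.2 h hh).2 _ hb)
    refine ⟨act h b', fun g hg => ?_⟩
    rw [eval_act, eval_act, Matrix.mulVec_mulVec, hb' _ (hG.2.1 _ hh _ hg), act_act, ← mul_assoc,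
      hG.inv_mul hh, one_mul]
  have hvan : ZPaper.vanishingIdeal ℂ n (orbit ℂ n G y) ≤ I := fun q hq b _ =>
    ⟨0, fun g hg => by rw [hq _ ⟨g, hg, rfl⟩, map_zero, zero_mul]⟩
  suffices hI : ∃ q ∈ I, ∃ g ∈ G, eval (g.mulVec y) q ≠ 0 by
    obtain ⟨q, hq, g₀, hg₀, hne⟩ := hI
    have htop := sup_vanishingIdeal_orbit_eq_top hG hy I hIst hq hg₀ hne
    rw [sup_eq_left.2 hvan] at htop
    have h1 : (1 : MvPolynomial (Fin n) ℂ) ∈ I := by rw [htop]; trivial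
    intro b hb
    obtain ⟨b', hb'⟩ := h1 b hb
    exact ⟨b', fun g hg => by rw [hb' g hg, map_one, one_mul]⟩
  obtain ⟨t, ht⟩ := (Module.Finite.iff_fg.1 (inferInstance : Module.Finite ℂ W))
  obtain ⟨q, hq, hqt⟩ := exists_denominator hG hGZ t l fun g hg h hh b hb => by
    rw [← act_act, hl h hh _ (hW g hg b (ht ▸ Submodule.subset_span hb))]
  refine ⟨q, fun b hb => ?_, hq⟩
  rw [← ht] at hb
  induction hb using Submodule.span_induction with
  | mem b hb => exact hqt b hb
  | zero => exact ⟨0, by simp⟩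
  | add x z _ _ hx hz =>
    obtain ⟨x', hx⟩ := hx
    obtain ⟨z', hz⟩ := hz
    exact ⟨x' + z', fun g hg => by rw [map_add, map_add, map_add, hx g hg, hz g hg, mul_add]⟩
  | smul a x _ hx =>
    obtain ⟨x', hx⟩ := hx
    exact ⟨a • x', fun g hg => by
      rw [smul_eval, map_smul, map_smul, hx g hg, smul_eq_mul, mul_left_comm]⟩

lemma eval_smul_of_isHomogeneous {n k : ℕ} {p : MvPolynomial (Fin n) ℂ} (hp : p.IsHomogeneous k)
    (c : ℂ) (v : Fin n → ℂ) : eval (c • v) p = c ^ k * eval v p := by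
  rw [eval_eq, eval_eq, Finset.mul_sum]
  refine Finset.sum_congr rfl fun m hm => ?_
  have hd : ∑ i ∈ m.support, m i = k := by
    simpa [Finsupp.weight_apply, Finsupp.sum] using hp (mem_support_iff.1 hm)
  simp only [Pi.smul_apply, smul_eq_mul, mul_pow, Finset.prod_mul_distrib,
    Finset.prod_pow_eq_pow_sum]
  rw [hd]
  ring

open Filter Topology in
/-- A polynomial vanishing along curves through the origin in every direction is zero. -/
lemma eq_zero_of_vanish_on_curves {n : ℕ} (F : MvPolynomial (Fin n) ℂ)
    (h : ∀ u : Fin n → ℂ, ∃ z : ℂ → Fin n → ℂ, z 0 = 0 ∧ HasDerivAt z u 0 ∧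
      ∀ ε, eval (z ε) F = 0) : F = 0 := by
  have key : ∀ l, homogeneousComponent l F = 0 := by
    intro l
    induction l using Nat.strong_induction_on with
    | _ l ih =>
      refine MvPolynomial.funext fun u => ?_
      obtain ⟨z, hz0, hz, hzF⟩ := h u
      rw [map_zero]
      let q : ℂ → Fin n → ℂ := dslope z 0
      have hq : ContinuousAt q 0 := continuousAt_dslope_same.2 hz.differentiableAt
      have hq0 : q 0 = u := by simp [q, hz.deriv]
      have hzq : ∀ ε, z ε = ε • q ε := fun ε => by
        have := sub_smul_dslope z 0 ε
        simpa [hz0] using this.symm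
      let d := F.totalDegree + 1 + l
      have hF : ∀ v, eval v F = ∑ k ∈ Finset.range (d + 1),
          eval v (homogeneousComponent k F) := fun v => by
        rw [← map_sum]
        conv_lhs => rw [← sum_homogeneousComponent F]
        congr 1
        refine Finset.sum_subset (by intro k; simp [d]; omega) fun k _ hk => ?_
        exact homogeneousComponent_eq_zero _ _ (by simp at hk; omega)
      let H : ℂ → ℂ := fun ε => ∑ k ∈ Finset.range (d + 1),
        ε ^ (k - l) * eval (q ε) (homogeneousComponent k F)
      have hH : ContinuousAt H 0 := by
        refine tendsto_finsetSum _ fun k _ => ?_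
        exact ((continuous_pow _).continuousAt).mul
          ((MvPolynomial.continuous_eval _).continuousAt.comp hq)
      have hH0 : H 0 = eval u (homogeneousComponent l F) := by
        change ∑ k ∈ Finset.range (d + 1), _ = _
        rw [Finset.sum_eq_single l]
        · simp [hq0]
        · intro k _ hkl
          rcases lt_or_gt_of_ne hkl with hk | hk
          · simp [ih k hk]
          · simp [Nat.sub_ne_zero_of_lt hk]
        · intro hl
          exact absurd (Finset.mem_range.2 (by omega)) hl
      have hHz : ∀ ε, ε ≠ 0 → H ε = 0 := fun ε hε => by
        have h1 : ε ^ l * H ε = 0 := by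
          rw [← hzF ε, hF, Finset.mul_sum]
          refine Finset.sum_congr rfl fun k _ => ?_
          rcases lt_or_ge k l with hk | hk
          · simp [ih k hk]
          · rw [hzq, eval_smul_of_isHomogeneous (homogeneousComponent_isHomogeneous k F),
              ← mul_assoc, ← pow_add, Nat.add_sub_cancel' hk]
        exact (mul_eq_zero.1 h1).resolve_left (pow_ne_zero _ hε)
      rw [← hH0]
      have h2 : Tendsto H (𝓝[≠] 0) (𝓝 (H 0)) := hH.tendsto.mono_left nhdsWithin_le_nhds
      refine tendsto_nhds_unique h2 (tendsto_const_nhds.congr' ?_)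
      filter_upwards [self_mem_nhdsWithin] with ε hε
      exact (hHz ε hε).symm
  rw [← sum_homogeneousComponent F]
  exact Finset.sum_eq_zero fun k _ => key k

/-- Derivatives at the identity of curves in a set of matrices, taken entrywise. -/
def curveTangents {n : ℕ} (G : Set (Matrix (Fin n) (Fin n) ℂ)) :
    Set (Matrix (Fin n) (Fin n) ℂ) :=
  {A | ∃ γ : ℂ → Matrix (Fin n) (Fin n) ℂ, γ 0 = 1 ∧ (∀ ε, γ ε ∈ G) ∧
    ∀ i j, HasDerivAt (fun ε => γ ε i j) (A i j) 0}

attribute [local instance] Matrix.linftyOpNormedRing Matrix.linftyOpNormedAlgebra in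
lemma hasDerivAt_mexp {n : ℕ} (A : Matrix (Fin n) (Fin n) ℂ) (i j : Fin n) :
    HasDerivAt (fun ε : ℂ => mexp ℂ n (ε • A) i j) (A i j) 0 := by
  have h := hasDerivAt_exp_smul_const (𝕂 := ℂ) A (0 : ℂ)
  rw [zero_smul, NormedSpace.exp_zero, one_mul] at h
  let L : Matrix (Fin n) (Fin n) ℂ →L[ℂ] ℂ :=
    LinearMap.toContinuousLinearMap (Matrix.entryLinearMap ℂ ℂ i j)
  have h2 := L.hasFDerivAt.comp_hasDerivAt (0 : ℂ) h
  have h3 : (fun ε : ℂ => mexp ℂ n (ε • A) i j) = L ∘ fun ε : ℂ => NormedSpace.exp (ε • A) := by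
    funext ε
    rw [mexp, Function.comp_apply, NormedSpace.exp_eq_tsum ℂ]
    rfl
  rw [h3]
  exact h2

lemma mem_curveTangents_of_mem_lieAlgebra {n : ℕ} {G : Set (Matrix (Fin n) (Fin n) ℂ)}
    {A : Matrix (Fin n) (Fin n) ℂ} (hA : A ∈ lieAlgebra ℂ n G) : A ∈ curveTangents G := by
  refine ⟨fun ε => mexp ℂ n (ε • A), ?_, hA, hasDerivAt_mexp A⟩
  simp only [zero_smul, mexp]
  rw [tsum_eq_single 0 fun k hk => by simp [hk]]
  simp

lemma exists_mem_curveTangents {n : ℕ} {G : Set (Matrix (Fin n) (Fin n) ℂ)}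
    (hG : IsMatSubgroup ℂ n G) {y v : Fin n → ℂ} (hv : v ∈ orbitTangent ℂ n G y) :
    ∃ A ∈ curveTangents G, A.mulVec y = v := by
  induction hv using Submodule.span_induction with
  | mem v hv =>
    obtain ⟨A, hA, rfl⟩ := hv
    exact ⟨A, mem_curveTangents_of_mem_lieAlgebra hA, rfl⟩
  | zero =>
    exact ⟨0, ⟨fun _ => 1, rfl, fun _ => hG.1, fun i j => hasDerivAt_const _ _⟩, by simp⟩
  | add v w _ _ hv hw =>
    obtain ⟨A, ⟨γ, hγ0, hγG, hγ⟩, rfl⟩ := hv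
    obtain ⟨B, ⟨δ, hδ0, hδG, hδ⟩, rfl⟩ := hw
    refine ⟨A + B, ⟨fun ε => γ ε * δ ε, by simp [hγ0, hδ0],
      fun ε => hG.2.1 _ (hγG ε) _ (hδG ε), fun i j => ?_⟩, Matrix.add_mulVec _ _ _⟩
    refine (HasDerivAt.fun_sum fun k (_ : k ∈ Finset.univ) =>
      (hγ i k).fun_mul (hδ k j)).congr_deriv ?_
    simp [hγ0, hδ0, Finset.sum_add_distrib, Matrix.one_apply]
  | smul c v _ hv =>
    obtain ⟨A, ⟨γ, hγ0, hγG, hγ⟩, rfl⟩ := hv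
    refine ⟨c • A, ⟨fun ε => γ (c * ε), by simp [hγ0], fun ε => hγG _, fun i j => ?_⟩,
      Matrix.smul_mulVec _ _ _⟩
    have h1 : HasDerivAt (fun ε : ℂ => c * ε) c 0 := by
      simpa using (hasDerivAt_id (0 : ℂ)).const_mul c
    have h2 : HasDerivAt (fun ε => γ ε i j) (A i j) (c * 0) := by simpa using hγ i j
    exact (h2.comp (0 : ℂ) h1).congr_deriv (mul_comm _ _)

/-- The translates of an affine slice are Zariski dense. -/
lemma eq_zero_of_vanish_slice {n : ℕ} {G : Set (Matrix (Fin n) (Fin n) ℂ)}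
    (hG : IsMatSubgroup ℂ n G) {y : Fin n → ℂ} {N : Submodule ℂ (Fin n → ℂ)}
    (hN : orbitTangent ℂ n G y ⊔ N = ⊤) {f : MvPolynomial (Fin n) ℂ}
    (hf : ∀ g ∈ G, ∀ w ∈ N, eval (g.mulVec (y + w)) f = 0) : f = 0 := by
  let F : MvPolynomial (Fin n) ℂ := aeval (fun i => X i + C (y i)) f
  have hF : ∀ v, eval v F = eval (v + y) f := fun v => by
    change eval v (bind₁ _ f) = _
    rw [← coe_aeval_eq_eval, ← coe_aeval_eq_eval, RingHom.coe_coe, RingHom.coe_coe, aeval_bind₁]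
    congr 2
    funext i
    simp
  have hF0 : F = 0 := by
    refine eq_zero_of_vanish_on_curves F fun u => ?_
    obtain ⟨v, hv, w, hw, rfl⟩ := Submodule.mem_sup.1 (hN ▸ Submodule.mem_top : u ∈ _)
    obtain ⟨A, ⟨γ, hγ0, hγG, hγ⟩, rfl⟩ := exists_mem_curveTangents hG hv
    refine ⟨fun ε => (γ ε).mulVec (y + ε • w) - y, by simp [hγ0], ?_, fun ε => ?_⟩
    · rw [hasDerivAt_pi]
      intro i
      have h1 : ∀ j, HasDerivAt (fun ε : ℂ => y j + ε * w j) (w j) 0 := fun j => by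
        simpa using ((hasDerivAt_id (0 : ℂ)).mul_const (w j)).const_add (y j)
      refine ((HasDerivAt.fun_sum fun j (_ : j ∈ Finset.univ) =>
        (hγ i j).fun_mul (h1 j)).sub_const (y i)).congr_deriv ?_
      simp [hγ0, Matrix.mulVec, dotProduct, Finset.sum_add_distrib, Matrix.one_apply]
    · rw [hF, sub_add_cancel]
      exact hf _ (hγG ε) _ (N.smul_mem _ hw)
  refine MvPolynomial.funext fun v => ?_
  have := hF (v - y)
  rw [hF0, sub_add_cancel] at this
  simpa using this.symm

/-- Coordinates on the image of a finite-dimensional subspace `W` in a quotient. -/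
lemma exists_dual_system {V : Type*} [AddCommGroup V] [Module ℂ V] (U W : Submodule ℂ V)
    [FiniteDimensional ℂ W] :
    ∃ (m : ℕ) (b : Fin m → V) (l : Fin m → V →ₗ[ℂ] ℂ), (∀ j, b j ∈ W) ∧
      (∀ i, ∀ u ∈ U, l i u = 0) ∧ (∀ i j, l i (b j) = if i = j then 1 else 0) ∧
      ∀ x ∈ W, x - ∑ j, l j x • b j ∈ U := by
  let Q : Submodule ℂ (V ⧸ U) := W.map U.mkQ
  let e := Module.finBasis ℂ Q
  have hb : ∀ j, ∃ b ∈ W, U.mkQ b = e j := fun j => Submodule.mem_map.1 (e j).2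
  choose b hbW hb using hb
  choose l hl using fun i => LinearMap.exists_extend (e.coord i)
  have hl' : ∀ i (q : Q), l i q = e.coord i q := fun i q => LinearMap.congr_fun (hl i) q
  refine ⟨_, b, fun i => l i ∘ₗ U.mkQ, hbW, fun i u hu => ?_, fun i j => ?_, fun x hx => ?_⟩
  · rw [LinearMap.comp_apply, Submodule.mkQ_apply, (Submodule.Quotient.mk_eq_zero U).2 hu, map_zero]
  · rw [LinearMap.comp_apply, hb, hl', Module.Basis.coord_apply, Module.Basis.repr_self,
      Finsupp.single_apply]
    simp only [eq_comm]
  · rw [← Submodule.Quotient.mk_eq_zero U, ← Submodule.mkQ_apply, map_sub, map_sum, sub_eq_zero]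
    let q : Q := ⟨U.mkQ x, Submodule.mem_map_of_mem hx⟩
    have h := congrArg (Subtype.val) (e.sum_repr q)
    rw [AddSubmonoidClass.coe_finsetSum] at h
    refine h.symm.trans (Finset.sum_congr rfl fun j _ => ?_)
    rw [map_smul, hb, LinearMap.comp_apply, show U.mkQ x = (q : V ⧸ U) from rfl, hl',
      Module.Basis.coord_apply, Submodule.coe_smul]

/-- A functional invariant under the isotropy group extends to an equivariant operator. -/
lemma exists_equivariant_of_functional {n : ℕ} {G : Set (Matrix (Fin n) (Fin n) ℂ)}
    (hG : IsReductiveGroup ℂ n G) {y : Fin n → ℂ} (hy : HasClosedOrbit ℂ n G y)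
    (W : Submodule ℂ (MvPolynomial (Fin n) ℂ)) [FiniteDimensional ℂ W]
    (hW : ∀ g ∈ G, ∀ b ∈ W, act g b ∈ W) (l : MvPolynomial (Fin n) ℂ →ₗ[ℂ] ℂ)
    (hl : ∀ h ∈ isotropy ℂ n G y, ∀ b ∈ W, l (act h b) = l b) :
    ∃ Φ : MvPolynomial (Fin n) ℂ →ₗ[ℂ] MvPolynomial (Fin n) ℂ,
      (∀ g ∈ G, ∀ b, Φ (act g b) = act g (Φ b)) ∧
      ∀ b ∈ W, ∀ g ∈ G, eval (g.mulVec y) (Φ b) = l (act g b) := by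
  let e := Module.finBasis ℂ W
  choose b' hb' using fun j => exists_poly_eq_functional hG.1 hG.2.1 hy W hW l hl (e j) (e j).2
  obtain ⟨Φ₀, hΦ₀⟩ := LinearMap.exists_extend (e.constr ℂ b')
  have key : ∀ b ∈ W, ∀ g ∈ G, eval (g.mulVec y) (Φ₀ b) = l (act g b) := by
    intro b hb g hg
    have : (aeval (g.mulVec y)).toLinearMap ∘ₗ e.constr ℂ b' =
        l ∘ₗ (act g).toLinearMap ∘ₗ W.subtype := by
      refine e.ext fun j => ?_
      simpa [Module.Basis.constr_basis] using hb' j g hg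
    have h2 := LinearMap.congr_fun this ⟨b, hb⟩
    rw [← hΦ₀] at h2
    simpa using h2
  obtain ⟨Φ, hΦ, hΦ'⟩ := exists_equivariant_average hG Φ₀
  refine ⟨Φ, hΦ, fun b hb k hk => hΦ' _ _ _ fun g hg => ?_⟩
  rw [Matrix.mulVec_mulVec, key _ (hW _ (hG.1.2.2 g hg).2 _ hb) _ (hG.1.2.1 _ hg _ hk), act_act,
    ← mul_assoc, hG.1.inv_mul hg, one_mul]

/-- Cramer's rule along a principal orbit. -/
lemma exists_cramer_system {n : ℕ} {G : Set (Matrix (Fin n) (Fin n) ℂ)}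
    (hG : IsReductiveGroup ℂ n G) {y : Fin n → ℂ} (hy : IsPrincipalPt ℂ n G y)
    {f : MvPolynomial (Fin n) ℂ} (hf : ∀ g ∈ G, eval (g.mulVec y) f = 0) :
    ∃ (m : ℕ) (φ a : Fin m → MvPolynomial (Fin n) ℂ) (D : MvPolynomial (Fin n) ℂ),
      eval y D = 1 ∧ (∀ i, eval y (a i) = 0) ∧ D * f = ∑ i, a i * φ i ∧
      ∀ g ∈ G, ∀ i, D * act g (a i) = a i * act g D := by
  obtain ⟨hcl, N, ⟨hN, -⟩, htriv⟩ := hy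
  let W := orbitSpan G f
  have hW : ∀ g ∈ G, ∀ b ∈ W, act g b ∈ W := fun g hg b hb => act_mem_orbitSpan hG.1 hb hg
  have hW0 : ∀ b ∈ W, eval y b = 0 := fun b hb => by
    induction hb using Submodule.span_induction with
    | mem b hb =>
      obtain ⟨g, hg, rfl⟩ := hb
      simpa using hf g hg
    | zero => simp
    | add b c _ _ hb hc => simp [hb, hc]
    | smul c b _ hb => simp [hb]
  let U : Submodule ℂ (MvPolynomial (Fin n) ℂ) :=
    Submodule.span ℂ {u | ∃ h ∈ isotropy ℂ n G y, ∃ b ∈ W, u = act h b - b}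
  obtain ⟨m, b, l, hbW, hlU, hlb, hbU⟩ := exists_dual_system U W
  have hl : ∀ i, ∀ h ∈ isotropy ℂ n G y, ∀ b ∈ W, l i (act h b) = l i b := fun i h hh b hb => by
    rw [← sub_eq_zero, ← map_sub]
    exact hlU i _ (Submodule.subset_span ⟨h, hh, b, hb, rfl⟩)
  choose Φ hΦ hΦl using fun i => exists_equivariant_of_functional hG hcl W hW (l i) (hl i)
  have hfun : ∀ L : MvPolynomial (Fin n) ℂ →ₗ[ℂ] ℂ,
      (∀ h ∈ isotropy ℂ n G y, ∀ b ∈ W, L (act h b) = L b) →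
      ∀ x ∈ W, L x = ∑ j, L (b j) * l j x := by
    intro L hL x hx
    have hU : U ≤ LinearMap.ker L := by
      rw [Submodule.span_le]
      rintro _ ⟨h, hh, b, hb, rfl⟩
      simp [hL h hh b hb]
    have := hU (hbU x hx)
    rw [LinearMap.mem_ker, map_sub, map_sum, sub_eq_zero] at this
    rw [this]
    exact Finset.sum_congr rfl fun j _ => by rw [map_smul, smul_eq_mul, mul_comm]
  have hfix : ∀ w ∈ N, ∀ h ∈ isotropy ℂ n G y, h.mulVec (y + w) = y + w := fun w hw h hh => by
    rw [Matrix.mulVec_add, hh.2, htriv h hh w hw]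
  let M : Matrix (Fin m) (Fin m) (MvPolynomial (Fin n) ℂ) := Matrix.of fun i j => Φ i (b j)
  let a : Fin m → MvPolynomial (Fin n) ℂ := Matrix.vecMul b M.adjugate
  let μ : (Fin n → ℂ) → Matrix (Fin m) (Fin m) ℂ := fun x => M.map (eval x)
  let β : (Fin n → ℂ) → Fin m → ℂ := fun x j => eval x (b j)
  let lam : Matrix (Fin n) (Fin n) ℂ → MvPolynomial (Fin n) ℂ → Fin m → ℂ :=
    fun g c j => l j (act g c)
  let Λ : Matrix (Fin n) (Fin n) ℂ → Matrix (Fin m) (Fin m) ℂ :=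
    fun g => Matrix.of fun j k => l j (act g (b k))
  have hD : ∀ x, eval x M.det = (μ x).det := fun x => RingHom.map_det _ _
  have ha : ∀ x i, eval x (a i) = Matrix.vecMul (β x) (μ x).adjugate i := fun x i => by
    have : (μ x).adjugate = M.adjugate.map (eval x) := ((eval x).map_adjugate M).symm
    simp [a, this, β, Matrix.vecMul, dotProduct]
  have hev : ∀ g ∈ G, ∀ w ∈ N, ∀ c ∈ W,
      eval (g.mulVec (y + w)) c = β (y + w) ⬝ᵥ lam g c := fun g hg w hw c hc => by
    have := hfun (aeval (y + w)).toLinearMap (fun h hh b _ => by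
      simpa using congrArg (fun v => eval v b) (hfix w hw h hh)) _ (hW g hg c hc)
    simpa [β, lam, dotProduct] using this
  have hevΦ : ∀ g ∈ G, ∀ w ∈ N, ∀ c ∈ W, ∀ i,
      eval (g.mulVec (y + w)) (Φ i c) = (μ (y + w)).mulVec (lam g c) i := fun g hg w hw c hc i => by
    have := hfun ((aeval (y + w)).toLinearMap ∘ₗ Φ i) (fun h hh b _ => by
      simpa [hΦ i h hh.1] using congrArg (fun v => eval v (Φ i b)) (hfix w hw h hh)) _
      (hW g hg c hc)
    simpa [μ, M, lam, Matrix.mulVec, dotProduct, hΦ i g hg] using this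
  have hμ : ∀ g ∈ G, ∀ w ∈ N, μ (g.mulVec (y + w)) = μ (y + w) * Λ g := fun g hg w hw => by
    ext i j
    exact hevΦ g hg w hw _ (hbW j) i
  have hβ : ∀ g ∈ G, ∀ w ∈ N, β (g.mulVec (y + w)) = Matrix.vecMul (β (y + w)) (Λ g) :=
    fun g hg w hw => funext fun j => hev g hg w hw _ (hbW j)
  have hD' : ∀ g ∈ G, ∀ w ∈ N,
      eval (g.mulVec (y + w)) M.det = (Λ g).det * (μ (y + w)).det := fun g hg w hw => by
    rw [hD, hμ g hg w hw, Matrix.det_mul, mul_comm]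
  have ha' : ∀ g ∈ G, ∀ w ∈ N, ∀ i, eval (g.mulVec (y + w)) (a i) =
      (Λ g).det * Matrix.vecMul (β (y + w)) (μ (y + w)).adjugate i := fun g hg w hw i => by
    rw [ha, hμ g hg w hw, hβ g hg w hw, Matrix.adjugate_mul_distrib, Matrix.vecMul_vecMul,
      ← mul_assoc, Matrix.mul_adjugate, Matrix.smul_mul, one_mul, Matrix.vecMul_smul,
      Pi.smul_apply, smul_eq_mul]
  refine ⟨m, fun i => Φ i f, a, M.det, ?_, fun i => ?_, ?_, fun g hg i => ?_⟩
  · have : μ y = 1 := by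
      ext i j
      have := hΦl i (b j) (hbW j) 1 hG.1.1
      rw [Matrix.one_mulVec, act_one, hlb] at this
      simpa [μ, M, Matrix.one_apply] using this
    rw [hD, this, Matrix.det_one]
  · have : β y = 0 := funext fun j => hW0 _ (hbW j)
    rw [ha, this, Matrix.zero_vecMul, Pi.zero_apply]
  · rw [← sub_eq_zero]
    refine eq_zero_of_vanish_slice hG.1 hN.sup_eq_top fun g hg w hw => ?_
    have hfW := self_mem_orbitSpan hG.1 f
    have h1 : ∑ i, Matrix.vecMul (β (y + w)) (μ (y + w)).adjugate i *
        (μ (y + w)).mulVec (lam g f) i = (μ (y + w)).det * (β (y + w) ⬝ᵥ lam g f) := by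
      change Matrix.vecMul (β (y + w)) (μ (y + w)).adjugate ⬝ᵥ (μ (y + w)).mulVec (lam g f) = _
      rw [← Matrix.dotProduct_mulVec, Matrix.mulVec_mulVec, Matrix.adjugate_mul,
        Matrix.smul_mulVec, Matrix.one_mulVec, dotProduct_smul, smul_eq_mul]
    rw [map_sub, map_mul, map_sum, hD' g hg w hw, hev g hg w hw f hfW, sub_eq_zero, mul_assoc,
      ← h1, Finset.mul_sum]
    exact Finset.sum_congr rfl fun i _ => by
      rw [map_mul, ha' g hg w hw, hevΦ g hg w hw f hfW, mul_assoc]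
  · rw [← sub_eq_zero]
    refine eq_zero_of_vanish_slice hG.1 hN.sup_eq_top fun k hk w hw => ?_
    rw [map_sub, map_mul, map_mul, eval_act, eval_act, Matrix.mulVec_mulVec,
      hD' k hk w hw, ha' k hk w hw, hD' _ (hG.1.2.1 _ hg _ hk) w hw,
      ha' _ (hG.1.2.1 _ hg _ hk) w hw]
    ring

/-- The ideal of a principal orbit is generated by invariants. -/
lemma mem_span_invariants_of_principal {n : ℕ} {G : Set (Matrix (Fin n) (Fin n) ℂ)}
    (hG : IsReductiveGroup ℂ n G) {y : Fin n → ℂ} (hy : IsPrincipalPt ℂ n G y)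
    {f : MvPolynomial (Fin n) ℂ} (hf : ∀ g ∈ G, eval (g.mulVec y) f = 0) :
    f ∈ Ideal.span {p | Invariant ℂ n G p ∧ eval y p = 0} := by
  obtain ⟨m, φ, a, D, hDy, hay, hDf, hDa⟩ := exists_cramer_system hG hy hf
  have hD0 : D ≠ 0 := fun h => by simp [h] at hDy
  have hgD0 : ∀ g ∈ G, act g D ≠ 0 := fun g hg h => hD0 <| by
    have := congrArg (act g⁻¹) h
    rwa [act_act, hG.1.mul_inv hg, act_one, map_zero] at this
  let I : Ideal (MvPolynomial (Fin n) ℂ) :=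
    { carrier := {d | ∀ i, ∃ c, d * a i = D * c}
      zero_mem' := fun i => ⟨0, by simp⟩
      add_mem' := fun {d e} hd he i => by
        obtain ⟨c, hc⟩ := hd i
        obtain ⟨c', hc'⟩ := he i
        exact ⟨c + c', by rw [add_mul, hc, hc', mul_add]⟩
      smul_mem' := fun r d hd i => by
        obtain ⟨c, hc⟩ := hd i
        exact ⟨r * c, by rw [smul_eq_mul, mul_assoc, hc, mul_left_comm]⟩ }
  have hI : ∀ g ∈ G, ∀ q ∈ I, act g q ∈ I := fun g hg d hd i => by
    obtain ⟨c, hc⟩ := hd i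
    refine ⟨act g c, mul_right_cancel₀ (hgD0 g hg) ?_⟩
    have h1 := congrArg (act g) hc
    rw [map_mul, map_mul] at h1
    linear_combination D * h1 - act g d * hDa g hg i
  have htop := sup_vanishingIdeal_orbit_eq_top hG.1 hy.1 I hI
    (show D ∈ I from fun i => ⟨a i, rfl⟩) hG.1.1 (by simp [hDy])
  obtain ⟨d, hd, e, he, hde⟩ := Submodule.mem_sup.1 ((Ideal.eq_top_iff_one _).1 htop)
  obtain ⟨p, hp, hpS, hpc⟩ := exists_invariant_average hG d
  have hpI : p ∈ I := hpS (I.restrictScalars ℂ) fun g hg => hI g hg d hd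
  have hpy : eval y p = 1 := hpc y 1 fun g hg => by
    have := congrArg (eval (g.mulVec y)) hde
    rwa [map_add, he _ ⟨g, hg, rfl⟩, add_zero, map_one] at this
  choose c hc using hpI
  have hcinv : ∀ i, Invariant ℂ n G (c i) := fun i g hg v => by
    rw [← eval_act]
    congr 1
    refine mul_left_cancel₀ (mul_ne_zero hD0 (hgD0 g hg)) ?_
    have h1 := congrArg (act g) (hc i)
    rw [map_mul, map_mul, hp.act_eq hg] at h1
    linear_combination p * hDa g hg i - D * h1 + act g D * hc i
  have hcy : ∀ i, eval y (c i) = 0 := fun i => by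
    have := congrArg (eval y) (hc i)
    rw [map_mul, map_mul, hDy, hay, mul_zero, one_mul] at this
    exact this.symm
  have hpf : p * f = ∑ i, c i * φ i := by
    refine mul_left_cancel₀ hD0 ?_
    rw [mul_left_comm, hDf, Finset.mul_sum, Finset.mul_sum]
    exact Finset.sum_congr rfl fun i _ => by rw [← mul_assoc, hc, mul_assoc]
  have hf' : f = ∑ i, c i * φ i + (1 - p) * f := by
    rw [← hpf]
    ring
  rw [hf']
  refine Ideal.add_mem _ (Ideal.sum_mem _ fun i _ => ?_) ?_
  · exact Ideal.mul_mem_right _ _ (Ideal.subset_span ⟨hcinv i, hcy i⟩)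
  · refine Ideal.mul_mem_right _ _ (Ideal.subset_span ⟨fun g hg v => ?_, by simp [hpy]⟩)
    simp [hp g hg v]

/-- Coefficients, in a basis over the invariants, of members of an ideal generated by
invariants vanishing at `y` vanish at `y`. -/
lemma eval_repr_eq_zero {n : ℕ} {G : Set (Matrix (Fin n) (Fin n) ℂ)} {ι : Type*}
    (b : Module.Basis ι (invariantSubalgebra ℂ n G) (MvPolynomial (Fin n) ℂ)) {y : Fin n → ℂ}
    {q : MvPolynomial (Fin n) ℂ} (hq : q ∈ Ideal.span {p | Invariant ℂ n G p ∧ eval y p = 0})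
    (i : ι) : eval y (b.repr q i : MvPolynomial (Fin n) ℂ) = 0 := by
  suffices h : ∀ r, eval y (b.repr (r * q) i : MvPolynomial (Fin n) ℂ) = 0 by
    simpa using h 1
  induction hq using Submodule.span_induction with
  | mem p hp =>
    intro r
    have : r * p = (⟨p, hp.1⟩ : invariantSubalgebra ℂ n G) • r := mul_comm _ _
    rw [this, map_smul, Finsupp.smul_apply, smul_eq_mul, MulMemClass.coe_mul, map_mul, hp.2,
      zero_mul]
  | zero => simp
  | add p q _ _ hp hq => simp [mul_add, hp, hq]
  | smul s p _ hp =>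
    intro r
    rw [smul_eq_mul, ← mul_assoc]
    exact hp _

/-- **Corollary 3.9.** Let `G` be a complex reductive group and `V = ℂⁿ` a stable cofree
`G`-module.  If `Y ⊆ V` is a `G`-stable algebraic subset such that `Y_pr` is Zariski dense
in `Y`, then `Y` is `G`-reduced. -/
theorem cofree_G_reduced_of_pr_dense
    (n : ℕ) (G : Set (Matrix (Fin n) (Fin n) ℂ)) (hG : IsReductiveGroup ℂ n G)
    (hstab : IsStableModule ℂ n G) (hcofree : IsCofree ℂ n G)
    (Y : Set (Fin n → ℂ)) (hYalg : IsAlgebraicSet ℂ n Y) (hYstab : Stabilizes ℂ n G Y)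
    (hdense : ZDenseIn ℂ n (Y ∩ prPoints ℂ n G) Y) :
    IsGReduced ℂ n G Y := by
  refine le_antisymm (Ideal.span_le.2 fun p hp => hp.2) fun f hf => ?_
  have hfree : Module.Free (invariantSubalgebra ℂ n G) (MvPolynomial (Fin n) ℂ) := hcofree
  let b := Module.Free.chooseBasis (invariantSubalgebra ℂ n G) (MvPolynomial (Fin n) ℂ)
  have hcoeff : ∀ i, ∀ x ∈ Y, eval x (b.repr f i : MvPolynomial (Fin n) ℂ) = 0 := fun i =>
    hdense _ fun y hy =>
      eval_repr_eq_zero b (mem_span_invariants_of_principal hG hy.2 fun g hg =>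
        hf _ (hYstab g hg y hy.1)) i
  rw [← b.linearCombination_repr f, Finsupp.linearCombination_apply]
  exact Ideal.sum_mem _ fun i _ =>
    Ideal.mul_mem_right _ _ (Ideal.subset_span ⟨(b.repr f i).2, hcoeff i⟩)

end ZPaper
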